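/- arXiv:2311.17793 — 2 statements merged into one kernel-verified Lean document; each statement's English description precedes it below -/
import Mathlib

section
/- If λ is an MAT-labeling of the complete graph K_ℓ, then for every k with 1 ≤ k ≤ ℓ−1, the number of edges with label k equals ℓ−k. -/
/-- An edge-labeling `lab : Sym2 V → ℕ` of a simple graph `G` is an MAT-labeling if
labels of edges are positive, (ML1) for every `k`, no edge of label `≤ k` forms a cycle
with edges of label `k` (i.e. the graph whose edges are the label-`k` edges together
with that edge is acyclic), and (ML2) every edge of label `k` forms exactly `k - 1`
triangles with edges of smaller label. -/
def MATLabeling {V : Type*} (G : SimpleGraph V) (lab : Sym2 V → ℕ) : Prop :=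
  (∀ e ∈ G.edgeSet, 1 ≤ lab e) ∧
  (∀ k : ℕ, ∀ e ∈ G.edgeSet, lab e ≤ k →
    (SimpleGraph.fromEdgeSet {f | (f ∈ G.edgeSet ∧ lab f = k) ∨ f = e}).IsAcyclic) ∧
  (∀ i j : V, G.Adj i j →
    {w : V | G.Adj w i ∧ G.Adj w j ∧ lab s(w, i) < lab s(i, j) ∧
      lab s(w, j) < lab s(i, j)}.ncard = lab s(i, j) - 1)

/-- A vertex `v` is MAT-simplicial in the edge-labeled graph `(G, lab)`:
(MS1) `v` is simplicial; (MS2) the labels of the edges incident on `v` are exactly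
`{1, …, deg v}`; (MS3) for distinct neighbors `u₁ u₂` of `v`,
`lab (u₁, u₂) < max (lab (u₁, v)) (lab (u₂, v))`. -/
def MATSimplicial {V : Type*} (G : SimpleGraph V) (lab : Sym2 V → ℕ) (v : V) : Prop :=
  (∀ u₁ ∈ G.neighborSet v, ∀ u₂ ∈ G.neighborSet v, u₁ ≠ u₂ → G.Adj u₁ u₂) ∧
  ((fun u => lab s(u, v)) '' G.neighborSet v = Set.Icc 1 (G.neighborSet v).ncard) ∧
  (∀ u₁ ∈ G.neighborSet v, ∀ u₂ ∈ G.neighborSet v, u₁ ≠ u₂ →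
    lab s(u₁, u₂) < max (lab s(u₁, v)) (lab s(u₂, v)))

namespace SimpleGraph

variable {V : Type*}

/-- `G.ReachIn X u v`: there is a walk from `u` to `v` in `G` all of whose edges lie in `X`. -/
def ReachIn (G : SimpleGraph V) (X : Set V) : V → V → Prop :=
  Relation.ReflTransGen fun u v => G.Adj u v ∧ u ∈ X ∧ v ∈ X

/-- Chordality, phrased through connectivity: two distinct neighbors of `w` joined by a walk
whose inner vertices are neither `w` nor neighbors of `w` are adjacent. -/
def IsChordal (G : SimpleGraph V) : Prop :=
  ∀ w z z' : V, G.Adj w z → G.Adj w z' → z ≠ z' →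
    G.ReachIn ({x | x ≠ w ∧ ¬ G.Adj w x} ∪ {z, z'}) z z' → G.Adj z z'

section ReachIn

variable {G H : SimpleGraph V} {X Y : Set V} {u v w a b : V}

lemma ReachIn.mono (hGH : G ≤ H) (hXY : X ⊆ Y) (h : G.ReachIn X u v) : H.ReachIn Y u v :=
  Relation.ReflTransGen.mono (fun _ _ h => ⟨hGH h.1, hXY h.2.1, hXY h.2.2⟩) _ _ h

lemma ReachIn.symm (h : G.ReachIn X u v) : G.ReachIn X v u := by
  induction h with
  | refl => exact .refl
  | tail _ h ih => exact Relation.ReflTransGen.head ⟨h.1.symm, h.2.2, h.2.1⟩ ih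

lemma ReachIn.trans (h : G.ReachIn X u v) (h' : G.ReachIn X v w) : G.ReachIn X u w :=
  Relation.ReflTransGen.trans h h'

lemma ReachIn.of_adj (h : G.Adj u v) (hu : u ∈ X) (hv : v ∈ X) : G.ReachIn X u v :=
  Relation.ReflTransGen.single ⟨h, hu, hv⟩

lemma ReachIn.mem (h : G.ReachIn X u v) (hu : u ∈ X) : v ∈ X := by
  induction h with
  | refl => exact hu
  | tail _ h _ => exact h.2.2

/-- A walk that reaches no vertex of `W` avoids `W`. -/
lemma ReachIn.diff {W : Set V} (h : G.ReachIn X u v) (hW : ∀ x ∈ W, ¬ G.ReachIn X u x) :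
    G.ReachIn Wᶜ u v := by
  induction h with
  | refl => exact .refl
  | tail h₁ h₂ ih =>
    exact ih.trans (.of_adj h₂.1 (fun hm => hW _ hm h₁)
      (fun hm => hW _ hm (Relation.ReflTransGen.tail h₁ h₂)))

/-- A walk in `G ⊔ edge a b` either can be realised in `G` or splits at the edge `ab`. -/
lemma ReachIn.sup_edge (h : (G ⊔ edge a b).ReachIn X u v) :
    G.ReachIn X u v ∨ (a ∈ X ∧ b ∈ X ∧ G.ReachIn X u a ∧ G.ReachIn X b v) ∨
      (a ∈ X ∧ b ∈ X ∧ G.ReachIn X u b ∧ G.ReachIn X a v) := by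
  induction h with
  | refl => exact .inl .refl
  | @tail p q _ h ih =>
    obtain ⟨hadj, hp, hq⟩ := h
    rw [sup_adj, edge_adj] at hadj
    rcases hadj with hadj | ⟨⟨rfl, rfl⟩ | ⟨rfl, rfl⟩, -⟩
    · have hs : G.ReachIn X p q := .of_adj hadj hp hq
      rcases ih with ih | ⟨h₁, h₂, h₃, h₄⟩ | ⟨h₁, h₂, h₃, h₄⟩
      · exact .inl (ih.trans hs)
      · exact .inr (.inl ⟨h₁, h₂, h₃, h₄.trans hs⟩)
      · exact .inr (.inr ⟨h₁, h₂, h₃, h₄.trans hs⟩)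
    · rcases ih with ih | ⟨h₁, h₂, h₃, h₄⟩ | ⟨h₁, h₂, h₃, h₄⟩
      · exact .inr (.inl ⟨hp, hq, ih, .refl⟩)
      · exact .inr (.inl ⟨h₁, h₂, h₃, .refl⟩)
      · exact .inl h₃
    · rcases ih with ih | ⟨h₁, h₂, h₃, h₄⟩ | ⟨h₁, h₂, h₃, h₄⟩
      · exact .inr (.inr ⟨hq, hp, ih, .refl⟩)
      · exact .inl h₃
      · exact .inr (.inr ⟨h₁, h₂, h₃, .refl⟩)

end ReachIn

section IsChordal

variable {G F : SimpleGraph V}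

/-- In a chordal graph, a walk between neighbors of `w` avoiding `w` can be rerouted through
neighbors of `w` only. -/
lemma IsChordal.reachIn_inter_neighborSet (hG : G.IsChordal) {X : Set V} {w x y : V}
    (hw : w ∉ X) (hx : G.Adj w x) (hy : G.Adj w y) (h : G.ReachIn X x y) :
    G.ReachIn (X ∩ {p | G.Adj w p}) x y := by
  suffices H : (G.Adj w y → G.ReachIn (X ∩ {p | G.Adj w p}) x y) ∧
      (¬ G.Adj w y → ∃ z ∈ X, G.Adj w z ∧ G.ReachIn (X ∩ {p | G.Adj w p}) x z ∧
        G.ReachIn ({p | p ≠ w ∧ ¬ G.Adj w p} ∪ {z}) z y) from H.1 hy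
  clear hy
  induction h with
  | refl => exact ⟨fun _ => .refl, fun h => absurd hx h⟩
  | @tail p q _ h ih =>
    obtain ⟨hpq, hp, hq⟩ := h
    have hpw : p ≠ w := fun h => hw (h ▸ hp)
    have hqw : q ≠ w := fun h => hw (h ▸ hq)
    by_cases hwp : G.Adj w p
    · refine ⟨fun hwq => (ih.1 hwp).trans (.of_adj hpq ⟨hp, hwp⟩ ⟨hq, hwq⟩), fun hwq => ?_⟩
      exact ⟨p, hp, hwp, ih.1 hwp, .of_adj hpq (.inr rfl) (.inl ⟨hqw, hwq⟩)⟩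
    · obtain ⟨z, hz, hwz, hxz, hzp⟩ := ih.2 hwp
      refine ⟨fun hwq => ?_, fun hwq => ?_⟩
      · by_cases hzq : z = q
        · exact hzq ▸ hxz
        · refine hxz.trans (.of_adj (hG w z q hwz hwq hzq ?_) ⟨hz, hwz⟩ ⟨hq, hwq⟩)
          refine (hzp.mono le_rfl ?_).trans (.of_adj hpq (.inl ⟨hpw, hwp⟩) (.inr (.inr rfl)))
          exact Set.union_subset_union_right _ (by simp)
      · exact ⟨z, hz, hwz, hxz, hzp.trans (.of_adj hpq (.inl ⟨hpw, hwp⟩) (.inl ⟨hqw, hwq⟩))⟩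

lemma IsChordal.reachIn_inter_forall_adj (hG : G.IsChordal) {X : Set V} {x y : V} (T : Finset V)
    (hT : ∀ w ∈ T, w ∉ X ∧ G.Adj w x ∧ G.Adj w y) (h : G.ReachIn X x y) :
    G.ReachIn (X ∩ {p | ∀ w ∈ T, G.Adj w p}) x y := by
  classical
  induction T using Finset.induction_on with
  | empty => simpa using h
  | insert w T _ ih =>
    have hw := hT w (by simp)
    refine (hG.reachIn_inter_neighborSet (fun h => hw.1 h.1) hw.2.1 hw.2.2
      (ih fun v hv => hT v (by simp [hv]))).mono le_rfl ?_
    rintro p ⟨⟨hp, hpT⟩, hwp⟩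
    exact ⟨hp, by simpa using ⟨hwp, hpT⟩⟩

/-- If a chordal graph has no clique larger than `|W| + 1`, then a clique `W` separates any two
vertices adjacent to all of `W`. -/
lemma IsChordal.eq_of_reachIn_compl (hG : G.IsChordal) {W : Finset V} {m : ℕ}
    (hm : G.CliqueFree (m + 2)) (hW : G.IsNClique m W) {x y : V}
    (hx : ∀ w ∈ W, G.Adj w x) (hy : ∀ w ∈ W, G.Adj w y)
    (h : G.ReachIn (↑W)ᶜ x y) : x = y := by
  classical
  have h' := hG.reachIn_inter_forall_adj W (fun w hw => ⟨by simpa using hw, hx w hw, hy w hw⟩) h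
  rcases Relation.ReflTransGen.cases_head h' with h' | ⟨p, ⟨hxp, -, hp⟩, -⟩
  · exact h'
  · refine absurd ((hW.insert fun w hw => (hp.2 w hw).symm).insert (a := x) ?_) (hm _)
    intro v hv
    rcases Finset.mem_insert.1 hv with rfl | hv
    · exact hxp
    · exact (hx v hv).symm

/-- The common neighbors of two nonadjacent vertices of a chordal graph form a clique. -/
lemma IsChordal.isClique_commonNeighbors (hG : G.IsChordal) {a b : V} (hab : a ≠ b)
    (h : ¬ G.Adj a b) : G.IsClique (G.commonNeighbors a b) := by
  rintro w ⟨hwa, hwb⟩ w' ⟨hwa', hwb'⟩ hne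
  simp only [mem_neighborSet] at hwa hwb hwa' hwb'
  refine hG a w w' hwa hwa' hne ?_
  exact ReachIn.trans (v := b) (.of_adj hwb.symm (by simp) (by simp [hab.symm, h]))
    (.of_adj hwb' (by simp [hab.symm, h]) (by simp))

/-- Adding an edge `ab` keeps a graph chordal if common neighbors of `a` and `b` separate them. -/
lemma IsChordal.sup_edge (hG : G.IsChordal) {a b : V} (hab : a ≠ b) {W : Set V}
    (hW : W ⊆ G.commonNeighbors a b) (hsep : ¬ G.ReachIn Wᶜ a b) : (G ⊔ edge a b).IsChordal := by
  have aux : ∀ a b : V, a ≠ b → W ⊆ G.commonNeighbors a b → ¬ G.ReachIn Wᶜ a b →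
      ∀ z, G.Adj a z → (G ⊔ edge a b).ReachIn
        ({x | x ≠ a ∧ ¬ (G ⊔ edge a b).Adj a x} ∪ {b, z}) b z → z ≠ b → G.Adj b z := by
    intro a b hab hW hsep z haz h hzb
    by_contra hbz
    have haW : a ∉ W := fun h => (G.irrefl (hW h).1)
    have hzW : z ∉ W := fun h => hbz (hW h).2
    have hbW : b ∉ W := fun h => (G.irrefl (hW h).2)
    have ha : a ∉ ({x | x ≠ a ∧ ¬ (G ⊔ edge a b).Adj a x} ∪ {b, z} : Set V) := by
      simp [hab, haz.ne]
    have hbz' : G.ReachIn Wᶜ b z := by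
      have : G.ReachIn ({x | x ≠ a ∧ ¬ (G ⊔ edge a b).Adj a x} ∪ {b, z}) b z := by
        rcases h.sup_edge with h | ⟨h, -⟩ | ⟨h, -⟩
        · exact h
        · exact absurd h ha
        · exact absurd h ha
      refine this.mono le_rfl ?_
      rintro x (hx | rfl | rfl) hxW
      · exact hx.2 (Or.inl (hW hxW).1)
      · exact hbW hxW
      · exact hzW hxW
    exact hsep (hbz'.trans (.of_adj haz.symm hzW haW)).symm
  have aux' : ∀ a b : V, a ≠ b → W ⊆ G.commonNeighbors a b → ¬ G.ReachIn Wᶜ a b →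
      ∀ z z', (G ⊔ edge a b).Adj a z → (G ⊔ edge a b).Adj a z' → z ≠ z' →
        (G ⊔ edge a b).ReachIn ({x | x ≠ a ∧ ¬ (G ⊔ edge a b).Adj a x} ∪ {z, z'}) z z' →
        (G ⊔ edge a b).Adj z z' := by
    intro a b hab hW hsep z z' hz hz' hne h
    have key : ∀ v, (G ⊔ edge a b).Adj a v → G.Adj a v ∨ v = b := by
      intro v hv
      rw [sup_adj, edge_adj] at hv
      rcases hv with hv | ⟨⟨-, rfl⟩ | ⟨h, -⟩, -⟩
      · exact .inl hv
      · exact .inr rfl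
      · exact absurd h hab
    rcases key z hz with haz | rfl
    · rcases key z' hz' with haz' | rfl
      · have ha : a ∉ ({x | x ≠ a ∧ ¬ (G ⊔ edge a b).Adj a x} ∪ {z, z'} : Set V) := by
          simp [haz.ne, haz'.ne]
        refine Or.inl (hG a z z' haz haz' hne ?_)
        rcases h.sup_edge with h | ⟨h, -⟩ | ⟨h, -⟩
        · refine h.mono le_rfl (Set.union_subset_union_left _ ?_)
          exact fun x hx => ⟨hx.1, fun h => hx.2 (Or.inl h)⟩
        · exact absurd h ha
        · exact absurd h ha
      · rw [Set.pair_comm] at h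
        exact Or.inl (aux a z' hab hW hsep z haz h.symm hne).symm
    · rcases key z' hz' with haz' | rfl
      · exact Or.inl (aux a z hab hW hsep z' haz' h hne.symm)
      · exact absurd rfl hne
  have hWab : ∀ x ∈ W, G.Adj a x ∧ G.Adj b x := fun x hx => hW hx
  intro w z z' hwz hwz' hne h
  by_cases hwa : w = a
  · subst hwa
    exact aux' w b hab hW hsep z z' hwz hwz' hne h
  by_cases hwb : w = b
  · subst hwb
    rw [edge_comm] at hwz hwz' h ⊢
    exact aux' w a hab.symm (commonNeighbors_symm G a w ▸ hW) (fun h => hsep h.symm)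
      z z' hwz hwz' hne h
  have key : ∀ v, (G ⊔ edge a b).Adj w v ↔ G.Adj w v := by
    intro v
    simp [edge_adj, hwa, hwb]
  simp only [key] at hwz hwz' h
  set Y : Set V := {x | x ≠ w ∧ ¬ G.Adj w x} ∪ {z, z'} with hY
  have hzY : z ∈ Y := by simp [hY]
  have hz'Y : z' ∈ Y := by simp [hY]
  have hwY : w ∉ Y := by simp [hY, hwz.ne, hwz'.ne]
  have cross : ∀ c d : V, c ∈ Y → d ∈ Y → (∀ x ∈ W, G.Adj c x ∧ G.Adj d x) →
      ¬ G.ReachIn Wᶜ c d → (∀ v v', v ∈ ({z, z'} : Set V) → v' ∈ ({z, z'} : Set V) →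
        v = c → v' = d → (G ⊔ edge a b).Adj z z') →
      G.ReachIn Y z c → G.ReachIn Y d z' → (G ⊔ edge a b).Adj z z' := by
    intro c d hc hd hW hsep hcd h₁ h₂
    by_cases hwW : w ∈ W
    · have hc' : c ∈ ({z, z'} : Set V) := hc.resolve_left fun h => h.2 (hW w hwW).1.symm
      have hd' : d ∈ ({z, z'} : Set V) := hd.resolve_left fun h => h.2 (hW w hwW).2.symm
      exact hcd c d hc' hd' rfl rfl
    by_cases h₃ : ∃ x ∈ W, G.ReachIn Y z x
    · obtain ⟨x, hx, hzx⟩ := h₃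
      exact Or.inl (hG w z z' hwz hwz' hne
        ((hzx.trans (.of_adj (hW x hx).2.symm (hzx.mem hzY) hd)).trans h₂))
    by_cases h₄ : ∃ x ∈ W, G.ReachIn Y z' x
    · obtain ⟨x, hx, hzx⟩ := h₄
      exact Or.inl (hG w z z' hwz hwz' hne
        (h₁.trans (.trans (.of_adj (hW x hx).1 hc (hzx.mem hz'Y)) hzx.symm)))
    push Not at h₃ h₄
    refine absurd ?_ hsep
    have hzW : z ∉ W := fun h => h₃ z h .refl
    have hz'W : z' ∉ W := fun h => h₄ z' h .refl
    exact (h₁.diff h₃).symm.trans ((ReachIn.of_adj hwz.symm hzW hwW).trans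
      ((ReachIn.of_adj hwz' hwW hz'W).trans (h₂.symm.diff h₄)))
  have hadj : (G ⊔ edge a b).Adj a b := by simp [edge_adj, hab]
  rcases h.sup_edge with h | ⟨ha, hb, h₁, h₂⟩ | ⟨ha, hb, h₁, h₂⟩
  · exact Or.inl (hG w z z' hwz hwz' hne h)
  · refine cross a b ha hb hWab hsep ?_ h₁ h₂
    rintro v v' (rfl | rfl) (rfl | rfl) rfl rfl
    all_goals first | exact absurd rfl hab | exact hadj | exact hadj.symm
  · refine cross b a hb ha (fun x hx => (hWab x hx).symm) (fun h => hsep h.symm) ?_ h₁ h₂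
    rintro v v' (rfl | rfl) (rfl | rfl) rfl rfl
    all_goals first | exact absurd rfl hab | exact hadj | exact hadj.symm

end IsChordal


section Step

variable {V : Type*} {G F : SimpleGraph V} {m : ℕ}

lemma IsChordal.exists_isNClique_commonNeighbors [Finite V] (hG : G.IsChordal)
    (hGF : ∀ u v, G.Adj u v → ¬ F.Reachable u v)
    (hcard : ∀ u v, F.Adj u v → (G.commonNeighbors u v).ncard = m) {a b : V} (hab : F.Adj a b) :
    ∃ W : Finset V, (W : Set V) = G.commonNeighbors a b ∧ G.IsNClique m W := by
  have hfin : (G.commonNeighbors a b).Finite := Set.toFinite _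
  refine ⟨hfin.toFinset, by simp, ?_, ?_⟩
  · simpa using hG.isClique_commonNeighbors hab.ne fun h => hGF a b h hab.reachable
  · rw [← Set.ncard_eq_toFinset_card _ hfin, hcard a b hab]

/-- Adding part of the forest `F` does not destroy the separation of `a` and `b`
by their common neighbors. -/
lemma IsChordal.not_reachIn_compl_commonNeighbors [Finite V] (hG : G.IsChordal) (hm : G.CliqueFree (m + 2))
    (hF : F.IsAcyclic) (hGF : ∀ u v, G.Adj u v → ¬ F.Reachable u v)
    (hcard : ∀ u v, F.Adj u v → (G.commonNeighbors u v).ncard = m) {S : SimpleGraph V}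
    (hS : S ≤ F) {a b : V} (hab : F.Adj a b) (habS : ¬ S.Adj a b) :
    ¬ (G ⊔ S).ReachIn (G.commonNeighbors a b)ᶜ a b := by
  intro h
  obtain ⟨W, hWeq, hW⟩ := hG.exists_isNClique_commonNeighbors hGF hcard hab
  rw [← hWeq] at h
  have hWab : ∀ w ∈ W, G.Adj a w ∧ G.Adj b w := fun w hw =>
    (hWeq ▸ Finset.mem_coe.2 hw : w ∈ G.commonNeighbors a b)
  have key : ∀ c, (G ⊔ S).ReachIn (↑W)ᶜ a c → ∃ x, (∀ w ∈ W, G.Adj w x) ∧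
      G.ReachIn (↑W)ᶜ x c ∧ (F.deleteEdges {s(a, b)}).Reachable a x := by
    intro c hc
    induction hc with
    | refl => exact ⟨a, fun w hw => (hWab w hw).1.symm, .refl, .refl a⟩
    | @tail p q _ h ih =>
      obtain ⟨x, hx, hxp, hax⟩ := ih
      obtain ⟨hpq, hp, hq⟩ := h
      rcases hpq with hpq | hpq
      · exact ⟨x, hx, hxp.trans (.of_adj hpq hp hq), hax⟩
      obtain ⟨W', hW'eq, hW'⟩ := hG.exists_isNClique_commonNeighbors hGF hcard (hS hpq)
      have hW'pq : ∀ w ∈ W', G.Adj p w ∧ G.Adj q w := fun w hw =>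
        (hW'eq ▸ Finset.mem_coe.2 hw : w ∈ G.commonNeighbors p q)
      by_cases hWW : W' ⊆ W
      · obtain rfl := Finset.eq_of_subset_of_card_le hWW (by rw [hW.card_eq, hW'.card_eq])
        obtain rfl := hG.eq_of_reachIn_compl hm hW hx (fun w hw => (hW'pq w hw).1.symm) hxp
        refine ⟨q, fun w hw => (hW'pq w hw).2.symm, .refl, hax.trans (Adj.reachable ?_)⟩
        rw [deleteEdges_adj]
        refine ⟨hS hpq, fun h => habS ?_⟩
        rw [Set.mem_singleton_iff] at h
        rwa [← mem_edgeSet, ← h, mem_edgeSet]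
      · obtain ⟨z, hz, hzW⟩ := Finset.not_subset.1 hWW
        exact ⟨x, hx, hxp.trans ((ReachIn.of_adj (hW'pq z hz).1 hp hzW).trans
          (.of_adj (hW'pq z hz).2.symm hzW hq)), hax⟩
  obtain ⟨x, hx, hxb, hax⟩ := key b h
  obtain rfl := hG.eq_of_reachIn_compl hm hW hx (fun w hw => (hWab w hw).2.symm) hxb
  exact isBridge_iff.1 (isAcyclic_iff_forall_isBridge.1 hF hab) hax

lemma IsChordal.sup_forest [Finite V] (hG : G.IsChordal) (hm : G.CliqueFree (m + 2))
    (hF : F.IsAcyclic) (hGF : ∀ u v, G.Adj u v → ¬ F.Reachable u v)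
    (hcard : ∀ u v, F.Adj u v → (G.commonNeighbors u v).ncard = m) : (G ⊔ F).IsChordal := by
  suffices H : ∀ S : Set (Sym2 V), S.Finite → S ⊆ F.edgeSet → (G ⊔ fromEdgeSet S).IsChordal by
    simpa using H F.edgeSet (Set.toFinite _) subset_rfl
  intro S hfin
  induction S, hfin using Set.Finite.induction_on with
  | empty => intro; simpa using hG
  | @insert e S he _ ih =>
    intro hS
    rw [Set.insert_subset_iff] at hS
    induction e with
    | h a b =>
      have hab : F.Adj a b := hS.1
      have heq : G ⊔ fromEdgeSet (insert s(a, b) S) = (G ⊔ fromEdgeSet S) ⊔ edge a b := by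
        rw [Set.insert_eq, fromEdgeSet_union, sup_assoc, sup_comm (fromEdgeSet S)]
        rfl
      rw [heq]
      have hSF : fromEdgeSet S ≤ F := by
        intro u v h
        exact hS.2 ((fromEdgeSet_adj _).1 h).1
      exact (ih hS.2).sup_edge hab.ne (W := G.commonNeighbors a b)
        (fun x hx => ⟨Or.inl hx.1, Or.inl hx.2⟩)
        (hG.not_reachIn_compl_commonNeighbors hm hF hGF hcard hSF hab
          fun h => he ((fromEdgeSet_adj _).1 h).1)

lemma IsChordal.cliqueFree_sup_forest (hG : G.IsChordal) (hm : G.CliqueFree (m + 2))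
    (hF : F.IsAcyclic) (hGF : ∀ u v, G.Adj u v → ¬ F.Reachable u v) :
    (G ⊔ F).CliqueFree (m + 3) := by
  classical
  intro Q hQ
  -- a triangle of `G ⊔ F` has at most one edge in `F`
  have tri : ∀ a b c, F.Adj a b → F.Adj b c → a ≠ c → ¬ (G ⊔ F).Adj a c := by
    rintro a b c hab hbc hac (h | h)
    · exact hGF a c h (hab.reachable.trans hbc.reachable)
    · exact hF.cliqueFree (n := 3) le_rfl {a, b, c} (is3Clique_triple_iff.2 ⟨hab, h, hbc⟩)
  have edge_of_card : ∀ R ⊆ Q, m + 2 ≤ R.card → ∃ a ∈ R, ∃ b ∈ R, F.Adj a b := by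
    intro R hR hcard
    by_contra! hno
    obtain ⟨T, hT, hTcard⟩ := Finset.exists_subset_card_eq hcard
    refine hm T ⟨fun u hu v hv huv => ?_, hTcard⟩
    exact (hQ.1 (hR (hT hu)) (hR (hT hv)) huv).resolve_right (hno u (hT hu) v (hT hv))
  obtain ⟨a, ha, b, hb, hab⟩ := edge_of_card Q subset_rfl (by rw [hQ.2]; omega)
  obtain ⟨c, hc, d, hd, hcd⟩ := edge_of_card (Q.erase a) (Finset.erase_subset _ _)
    (by rw [Finset.card_erase_of_mem ha, hQ.2]; omega)
  obtain ⟨hca, hc⟩ := Finset.mem_erase.1 hc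
  obtain ⟨hda, hd⟩ := Finset.mem_erase.1 hd
  by_cases hbc : b = c
  · subst hbc
    exact tri a b d hab hcd hda.symm (hQ.1 ha hd hda.symm)
  by_cases hbd : b = d
  · subst hbd
    exact tri a b c hab hcd.symm hca.symm (hQ.1 ha hc hca.symm)
  have hac : G.Adj a c := (hQ.1 ha hc hca.symm).resolve_right fun h =>
    tri b a c hab.symm h hbc (hQ.1 hb hc hbc)
  have had : G.Adj a d := (hQ.1 ha hd hda.symm).resolve_right fun h =>
    tri b a d hab.symm h hbd (hQ.1 hb hd hbd)
  have hbc' : G.Adj b c := (hQ.1 hb hc hbc).resolve_right fun h =>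
    tri a b c hab h hca.symm (hQ.1 ha hc hca.symm)
  have hbd' : G.Adj b d := (hQ.1 hb hd hbd).resolve_right fun h =>
    tri a b d hab h hda.symm (hQ.1 ha hd hda.symm)
  refine hGF c d (hG.isClique_commonNeighbors hab.ne (fun h => hGF a b h hab.reachable)
    ⟨hac, hbc'⟩ ⟨had, hbd'⟩ hcd.ne) hcd.reachable

/-- A forest has at most `|V| - c` edges, where `c` is the number of its components. -/
lemma IsAcyclic.ncard_edgeSet_add_card_connectedComponent_le [Finite V] (hF : F.IsAcyclic) :
    F.edgeSet.ncard + Nat.card F.ConnectedComponent ≤ Nat.card V := by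
  induction hn : F.edgeSet.ncard generalizing F with
  | zero =>
    rw [zero_add]
    exact Nat.card_le_card_of_surjective F.connectedComponentMk fun c => c.exists_rep
  | succ n ih =>
    obtain ⟨e, he⟩ : F.edgeSet.Nonempty := by
      rw [← Set.ncard_pos (Set.toFinite _)]; omega
    induction e with
    | h a b =>
      have hle : F.deleteEdges {s(a, b)} ≤ F := deleteEdges_le _
      have h₁ := ih (hF.anti hle) (by
        rw [edgeSet_deleteEdges, Set.ncard_sdiff_singleton_of_mem he, hn]; rfl)
      have h₂ : Nat.card F.ConnectedComponent <
          Nat.card (F.deleteEdges {s(a, b)}).ConnectedComponent := by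
        have hsurj := ConnectedComponent.surjective_map_ofLE hle
        refine lt_of_le_of_ne (Nat.card_le_card_of_surjective _ hsurj) fun heq => ?_
        have hbij := (Nat.bijective_iff_surjective_and_card _).2 ⟨hsurj, heq.symm⟩
        refine isBridge_iff.1 (isAcyclic_iff_forall_isBridge.1 hF he) ?_
        rw [← ConnectedComponent.eq]
        apply hbij.1
        simpa using Adj.reachable he
      omega

lemma IsChordal.ncard_edgeSet_forest_le [Finite V] (hG : G.IsChordal)
    (hF : F.IsAcyclic) (hGF : ∀ u v, G.Adj u v → ¬ F.Reachable u v)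
    (hcard : ∀ u v, F.Adj u v → (G.commonNeighbors u v).ncard = m) :
    F.edgeSet.ncard ≤ Nat.card V - (m + 1) := by
  classical
  rcases F.edgeSet.eq_empty_or_nonempty with h | ⟨e, he⟩
  · simp [h]
  induction e with
  | h a b =>
    obtain ⟨W, hWeq, hW⟩ := hG.exists_isNClique_commonNeighbors hGF hcard he
    have hQ : G.IsNClique (m + 1) (insert a W) := hW.insert fun w hw =>
      (hWeq ▸ Finset.mem_coe.2 hw : w ∈ G.commonNeighbors a b).1
    have hinj : Function.Injective fun q : ↥(insert a W) => F.connectedComponentMk q.1 := by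
      intro u v huv
      by_contra hne
      exact hGF _ _ (hQ.1 u.2 v.2 fun h => hne (Subtype.ext h)) (ConnectedComponent.eq.1 huv)
    have h₁ := Nat.card_le_card_of_injective _ hinj
    rw [Nat.card_eq_fintype_card, Fintype.card_coe, hQ.2] at h₁
    have h₂ := hF.ncard_edgeSet_add_card_connectedComponent_le
    omega

end Step

end SimpleGraph

section MATLabeling

open SimpleGraph

variable {V : Type*} {lab : Sym2 V → ℕ}

/-- The graph of edges with label less than `k`. -/
def labelLT (lab : Sym2 V → ℕ) (k : ℕ) : SimpleGraph V := fromEdgeSet {e | lab e < k}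

/-- The graph of edges with label `k`. -/
def labelEq (lab : Sym2 V → ℕ) (k : ℕ) : SimpleGraph V := fromEdgeSet {e | lab e = k}

lemma labelLT_succ (k : ℕ) : labelLT lab (k + 1) = labelLT lab k ⊔ labelEq lab k := by
  ext u v
  simp only [labelLT, labelEq, sup_adj, fromEdgeSet_adj, Set.mem_ofPred_eq, Nat.lt_succ_iff_lt_or_eq]
  tauto

lemma edgeSet_labelEq (k : ℕ) :
    (labelEq lab k).edgeSet = {e ∈ (⊤ : SimpleGraph V).edgeSet | lab e = k} := by
  ext e
  simp [labelEq, and_comm]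

namespace MATLabeling

lemma fromEdgeSet_isAcyclic (h : MATLabeling (⊤ : SimpleGraph V) lab) {k : ℕ} {u v : V}
    (huv : u ≠ v) (hk : lab s(u, v) ≤ k) : (labelEq lab k ⊔ edge u v).IsAcyclic := by
  refine (h.2.1 k s(u, v) (by simpa using huv) hk).anti ?_
  rintro x y (hxy | hxy)
  · rw [labelEq, fromEdgeSet_adj] at hxy
    exact (fromEdgeSet_adj _).2 ⟨.inl ⟨by simpa using hxy.2, hxy.1⟩, hxy.2⟩
  · exact (fromEdgeSet_adj _).2 ⟨.inr ((fromEdgeSet_adj _).1 hxy).1, hxy.ne⟩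

lemma labelEq_isAcyclic (h : MATLabeling (⊤ : SimpleGraph V) lab) (k : ℕ) :
    (labelEq lab k).IsAcyclic := by
  by_cases hb : labelEq lab k = ⊥
  · simp [hb]
  · obtain ⟨u, v, huv⟩ := ne_bot_iff_exists_adj.1 hb
    exact (h.fromEdgeSet_isAcyclic huv.ne ((fromEdgeSet_adj _).1 huv).1.le).anti le_sup_left

lemma not_reachable_labelEq (h : MATLabeling (⊤ : SimpleGraph V) lab) {k : ℕ} (u v : V)
    (huv : (labelLT lab k).Adj u v) : ¬ (labelEq lab k).Reachable u v := by
  intro hr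
  obtain ⟨hlt, hne⟩ := (fromEdgeSet_adj _).1 huv
  rw [Set.mem_ofPred_eq] at hlt
  have hac := h.fromEdgeSet_isAcyclic hne hlt.le
  have hadj : (labelEq lab k ⊔ edge u v).Adj u v := by simp [edge_adj, hne]
  refine isBridge_iff.1 (isAcyclic_iff_forall_isBridge.1 hac hadj) (hr.mono fun x y hxy => ?_)
  rw [deleteEdges_adj]
  refine ⟨.inl hxy, fun he => hlt.ne ?_⟩
  rw [← Set.mem_singleton_iff.1 he]
  exact ((fromEdgeSet_adj _).1 hxy).1

lemma ncard_commonNeighbors (h : MATLabeling (⊤ : SimpleGraph V) lab) {k : ℕ} (u v : V)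
    (huv : (labelEq lab k).Adj u v) : ((labelLT lab k).commonNeighbors u v).ncard = k - 1 := by
  obtain ⟨hk, hne⟩ := (fromEdgeSet_adj _).1 huv
  rw [Set.mem_ofPred_eq] at hk
  rw [← hk, ← h.2.2 u v (by simpa using hne)]
  congr 1
  ext w
  simp only [labelLT, mem_commonNeighbors, fromEdgeSet_adj, Set.mem_ofPred_eq, top_adj,
    Sym2.eq_swap (a := w), ne_comm (a := w)]
  tauto

lemma isChordal_and_cliqueFree [Finite V] (h : MATLabeling (⊤ : SimpleGraph V) lab) (m : ℕ) :
    (labelLT lab (m + 1)).IsChordal ∧ (labelLT lab (m + 1)).CliqueFree (m + 2) := by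
  induction m with
  | zero =>
    have hbot : labelLT lab (0 + 1) = ⊥ := by
      ext u v
      simp only [labelLT, fromEdgeSet_adj, Set.mem_ofPred_eq, bot_adj, iff_false, not_and]
      intro hlt hne
      have := h.1 s(u, v) (by simpa using hne)
      omega
    rw [hbot]
    exact ⟨fun _ _ _ h => h.elim, cliqueFree_bot le_rfl⟩
  | succ m ih =>
    rw [labelLT_succ (m + 1)]
    exact ⟨ih.1.sup_forest ih.2 (h.labelEq_isAcyclic _) h.not_reachable_labelEq
      h.ncard_commonNeighbors, ih.1.cliqueFree_sup_forest ih.2 (h.labelEq_isAcyclic _)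
      h.not_reachable_labelEq⟩

lemma ncard_label_le [Finite V] (h : MATLabeling (⊤ : SimpleGraph V) lab) {k : ℕ} (hk : 1 ≤ k) :
    {e ∈ (⊤ : SimpleGraph V).edgeSet | lab e = k}.ncard ≤ Nat.card V - k := by
  obtain ⟨m, rfl⟩ := Nat.exists_eq_add_of_le' hk
  rw [← edgeSet_labelEq]
  exact (h.isChordal_and_cliqueFree m).1.ncard_edgeSet_forest_le (h.labelEq_isAcyclic _)
    h.not_reachable_labelEq h.ncard_commonNeighbors

end MATLabeling

end MATLabeling

/-- If `lab` is an MAT-labeling of the complete graph on `ℓ` vertices, then for every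
`1 ≤ k ≤ ℓ - 1` the number of edges of label `k` is `ℓ - k`. -/
theorem card_label_eq_of_MATLabeling_complete (ℓ : ℕ) (lab : Sym2 (Fin ℓ) → ℕ)
    (h : MATLabeling (⊤ : SimpleGraph (Fin ℓ)) lab) :
    ∀ k : ℕ, 1 ≤ k → k ≤ ℓ - 1 →
      {e ∈ (⊤ : SimpleGraph (Fin ℓ)).edgeSet | lab e = k}.ncard = ℓ - k := by
  classical
  have hle : ∀ k, 1 ≤ k → {e ∈ (⊤ : SimpleGraph (Fin ℓ)).edgeSet | lab e = k}.ncard ≤ ℓ - k := by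
    intro k hk
    simpa using h.ncard_label_le hk
  have hmaps : ∀ e ∈ (⊤ : SimpleGraph (Fin ℓ)).edgeFinset, lab e ∈ Finset.Icc 1 (ℓ - 1) := by
    intro e he
    rw [SimpleGraph.mem_edgeFinset] at he
    have hpos := h.1 e he
    have : 0 < {f ∈ (⊤ : SimpleGraph (Fin ℓ)).edgeSet | lab f = lab e}.ncard :=
      (Set.ncard_pos (Set.toFinite _)).2 ⟨e, he, rfl⟩
    have := hle (lab e) hpos
    rw [Finset.mem_Icc]
    omega
  have hncard : ∀ k, {e ∈ (⊤ : SimpleGraph (Fin ℓ)).edgeSet | lab e = k}.ncard =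
      ((⊤ : SimpleGraph (Fin ℓ)).edgeFinset.filter fun e => lab e = k).card := by
    intro k
    rw [← Set.ncard_coe_finset]
    congr 1
    ext e
    simp
  have hsum := Finset.card_eq_sum_card_fiberwise hmaps
  rw [SimpleGraph.card_edgeFinset_top_eq_card_choose_two, Fintype.card_fin] at hsum
  have hgauss : ∑ k ∈ Finset.Icc 1 (ℓ - 1), (ℓ - k) = ℓ.choose 2 := by
    cases ℓ with
    | zero => simp
    | succ n =>
      rw [Nat.choose_two_right, ← Finset.sum_range_id, ← Finset.sum_range_reflect,
        Finset.sum_range_succ, ← Finset.Ico_add_one_right_eq_Icc, Finset.sum_Ico_eq_sum_range]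
      simp only [Nat.add_sub_cancel, Nat.sub_self, add_zero]
      exact Finset.sum_congr rfl fun i _ => by omega
  intro k hk hkl
  rw [hncard]
  refine (Finset.sum_eq_sum_iff_of_le (s := Finset.Icc 1 (ℓ - 1)) fun i hi => ?_).1
    (hsum.symm.trans hgauss.symm) k (Finset.mem_Icc.2 ⟨hk, hkl⟩)
  rw [← hncard]
  exact hle i (Finset.mem_Icc.1 hi).1
end

section
/- An edge-labeled graph (G, λ) is an MAT-labeled graph if and only if there exists an ordering (v_1, ..., v_ℓ) of its vertices such that for each i, the vertex v_i is MAT-simplicial in the induced edge-labeled subgraph on {v_1, ..., v_i}. -/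
namespace MATGraph

variable {V : Type*} {l : V → V → ℕ} {A B : Finset V} {v : V}

/-- A labelled graph encoded by a symmetric function vanishing exactly off the edges. -/
structure IsLabelFun (l : V → V → ℕ) : Prop where
  symm : ∀ a b, l a b = l b a
  self : ∀ a, l a a = 0

/-- The neighbours of `v` inside `A`. -/
def nbhd (l : V → V → ℕ) (A : Finset V) (v : V) : Finset V := A.filter (0 < l · v)

@[simp] lemma mem_nbhd {u : V} : u ∈ nbhd l A v ↔ u ∈ A ∧ 0 < l u v := by simp [nbhd]

/-- `v` is MAT-simplicial in the subgraph induced on `insert v A`. -/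
structure SimplicialIn (l : V → V → ℕ) (A : Finset V) (v : V) : Prop where
  adj : ∀ a ∈ A, ∀ b ∈ A, a ≠ b → 0 < l a v → 0 < l b v →
    0 < l a b ∧ l a b < max (l a v) (l b v)
  labels : (nbhd l A v).image (l · v) = Finset.Icc 1 (nbhd l A v).card

/-- Step along an edge of label `k` inside `A`, other than the edge `xy`. -/
def Step (l : V → V → ℕ) (A : Finset V) (k : ℕ) (x y a b : V) : Prop :=
  a ∈ A ∧ b ∈ A ∧ l a b = k ∧ s(a, b) ≠ s(x, y)

/-- The apexes of the triangles formed by the edge `xy` with edges of smaller label. -/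
def apexes (l : V → V → ℕ) (A : Finset V) (x y : V) : Finset V :=
  A.filter fun w => (0 < l w x ∧ l w x < l x y) ∧ (0 < l w y ∧ l w y < l x y)

lemma mem_apexes {x y w : V} : w ∈ apexes l A x y ↔
    w ∈ A ∧ (0 < l w x ∧ l w x < l x y) ∧ (0 < l w y ∧ l w y < l x y) := by
  simp [apexes]

/-- The labelling of the subgraph induced on `A` is an MAT-labeling. -/
structure LabelingOn (l : V → V → ℕ) (A : Finset V) : Prop where
  acyclic : ∀ k, ∀ x ∈ A, ∀ y ∈ A, 0 < l x y → l x y ≤ k →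
    ¬ Relation.ReflTransGen (Step l A k x y) x y
  triangles : ∀ x ∈ A, ∀ y ∈ A, 0 < l x y → (apexes l A x y).card = l x y - 1

/-- Forget the edges of label at least `n`. -/
def trunc (n : ℕ) (l : V → V → ℕ) (a b : V) : ℕ := if l a b < n then l a b else 0

lemma IsLabelFun.trunc (hl : IsLabelFun l) (n : ℕ) : IsLabelFun (trunc n l) := by
  constructor
  · intro a b; simp [MATGraph.trunc, hl.symm a b]
  · intro a; simp [MATGraph.trunc, hl.self a]

lemma trunc_pos_iff {n : ℕ} {a b : V} : 0 < trunc n l a b ↔ 0 < l a b ∧ l a b < n := by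
  unfold trunc; split_ifs <;> omega

lemma trunc_eq {n : ℕ} {a b : V} (h : l a b < n) : trunc n l a b = l a b := by
  simp [trunc, h]

lemma SimplicialIn.injOn (h : SimplicialIn l A v) :
    Set.InjOn (l · v) (nbhd l A v : Set V) := by
  rw [← Finset.card_image_iff, h.labels]; simp

lemma SimplicialIn.le_card (h : SimplicialIn l A v) {u : V} (hu : u ∈ nbhd l A v) :
    l u v ≤ (nbhd l A v).card := by
  have := Finset.mem_image_of_mem (l · v) hu
  rw [h.labels, Finset.mem_Icc] at this
  exact this.2

lemma SimplicialIn.exists_label (h : SimplicialIn l A v) {k : ℕ} (h1 : 1 ≤ k)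
    (h2 : k ≤ (nbhd l A v).card) : ∃ u ∈ A, l u v = k := by
  have : k ∈ (nbhd l A v).image (l · v) := by rw [h.labels]; simp [h1, h2]
  obtain ⟨u, hu, rfl⟩ := Finset.mem_image.1 this
  exact ⟨u, (mem_nbhd.1 hu).1, rfl⟩

lemma SimplicialIn.card_le (h : SimplicialIn l A v) {n : ℕ} (hn : ∀ u ∈ A, l u v ≤ n) :
    (nbhd l A v).card ≤ n := by
  by_contra! hc
  obtain ⟨u, hu, e⟩ := h.exists_label (k := (nbhd l A v).card) (by omega) le_rfl
  have := hn u hu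
  omega

lemma SimplicialIn.card_lt (h : SimplicialIn l A v) {n : ℕ} (hn : ∀ u ∈ A, l u v < n) (h1 : 0 < n) :
    (nbhd l A v).card < n := by
  have := h.card_le (n := n - 1) (fun u hu => by have := hn u hu; omega)
  omega

/-- Adding vertices not adjacent to `v` keeps `v` simplicial. -/
lemma SimplicialIn.mono (h : SimplicialIn l B v) (hBA : B ⊆ A)
    (hA : ∀ u ∈ A, u ∉ B → l u v = 0) : SimplicialIn l A v := by
  have hmem : ∀ u ∈ A, 0 < l u v → u ∈ B := fun u hu hp => by
    by_contra hc
    have := hA u hu hc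
    omega
  have hN : nbhd l A v = nbhd l B v := by
    ext u; simp only [mem_nbhd]
    exact ⟨fun ⟨a, b⟩ => ⟨hmem u a b, b⟩, fun ⟨a, b⟩ => ⟨hBA a, b⟩⟩
  refine ⟨fun a ha b hb hab pa pb => h.adj a (hmem a ha pa) b (hmem b hb pb) hab pa pb, ?_⟩
  rw [hN, h.labels]

lemma LabelingOn.mono (h : LabelingOn l A) (hBA : B ⊆ A)
    (hB : ∀ x ∈ B, ∀ y ∈ B, ∀ w ∈ A, w ∉ B → 0 < l w x → l w x < l x y → 0 < l w y →
      l w y < l x y → False) : LabelingOn l B := by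
  constructor
  · intro k x hx y hy h0 hk hr
    refine h.acyclic k x (hBA hx) y (hBA hy) h0 hk (Relation.ReflTransGen.mono ?_ _ _ hr)
    rintro a b ⟨ha, hb, hab⟩
    exact ⟨hBA ha, hBA hb, hab⟩
  · intro x hx y hy h0
    rw [← h.triangles x (hBA hx) y (hBA hy) h0]
    congr 1
    ext w
    simp only [mem_apexes]
    refine ⟨fun ⟨a, b⟩ => ⟨hBA a, b⟩, fun ⟨a, b⟩ => ⟨?_, b⟩⟩
    by_contra hw
    exact hB x hx y hy w a hw b.1.1 b.1.2 b.2.1 b.2.2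

lemma LabelingOn.trunc (h : LabelingOn l A) (n : ℕ) :
    LabelingOn (trunc n l) A := by
  constructor
  · intro k x hx y hy h0 hk hr
    have hxy := trunc_pos_iff.1 h0
    rw [trunc_eq hxy.2] at hk
    refine h.acyclic k x hx y hy hxy.1 hk (Relation.ReflTransGen.mono ?_ _ _ hr)
    rintro a b ⟨ha, hb, hab, hne⟩
    refine ⟨ha, hb, ?_, hne⟩
    have : 0 < MATGraph.trunc n l a b := by omega
    rw [trunc_eq (trunc_pos_iff.1 this).2] at hab
    exact hab
  · intro x hx y hy h0
    have hxy := trunc_pos_iff.1 h0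
    rw [trunc_eq hxy.2, ← h.triangles x hx y hy hxy.1]
    congr 1
    ext w
    simp only [mem_apexes, trunc_eq hxy.2, trunc_pos_iff]
    constructor
    · rintro ⟨hw, ⟨⟨a, b⟩, c⟩, ⟨d, e⟩, f⟩
      rw [trunc_eq b] at c
      rw [trunc_eq e] at f
      exact ⟨hw, ⟨a, c⟩, d, f⟩
    · rintro ⟨hw, ⟨a, c⟩, d, f⟩
      have b := c.trans hxy.2
      have e := f.trans hxy.2
      rw [trunc_eq b, trunc_eq e]
      exact ⟨hw, ⟨⟨a, b⟩, c⟩, ⟨d, e⟩, f⟩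

lemma SimplicialIn.of_trunc {n : ℕ} (hn : ∀ a b, l a b ≤ n)
    (h : SimplicialIn (MATGraph.trunc n l) A v) : SimplicialIn l (A.filter (l · v ≠ n)) v := by
  have hN : nbhd l (A.filter (l · v ≠ n)) v = nbhd (MATGraph.trunc n l) A v := by
    ext u
    have := hn u v
    simp only [mem_nbhd, Finset.mem_filter, trunc_pos_iff]
    constructor
    · rintro ⟨⟨a, b⟩, c⟩; exact ⟨a, c, by omega⟩
    · rintro ⟨a, b, c⟩; exact ⟨⟨a, by omega⟩, b⟩
  constructor
  · intro a ha b hb hab pa pb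
    rw [Finset.mem_filter] at ha hb
    have hna : l a v < n := by have := hn a v; omega
    have hnb : l b v < n := by have := hn b v; omega
    have := h.adj a ha.1 b hb.1 hab (trunc_pos_iff.2 ⟨pa, hna⟩) (trunc_pos_iff.2 ⟨pb, hnb⟩)
    have h2 := trunc_pos_iff.1 this.1
    rw [trunc_eq hna, trunc_eq hnb, trunc_eq h2.2] at this
    exact this
  · rw [hN, ← h.labels]
    refine Finset.image_congr fun u hu => ?_
    have := (mem_nbhd.1 hu).2
    exact (trunc_eq (trunc_pos_iff.1 this).2).symm

lemma apexes_comm (hl : IsLabelFun l) (x y : V) : apexes l A x y = apexes l A y x := by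
  ext w
  simp only [mem_apexes, hl.symm x y]
  tauto

lemma Step.symm (hl : IsLabelFun l) {k : ℕ} {x y a b : V} (h : Step l A k x y a b) :
    Step l A k y x b a := by
  obtain ⟨ha, hb, hab, hne⟩ := h
  exact ⟨hb, ha, by rw [hl.symm, hab], by rwa [Sym2.eq_swap, Sym2.eq_swap (a := y)]⟩

lemma reflTransGen_step_symm (hl : IsLabelFun l) {k : ℕ} {x y a b : V}
    (h : Relation.ReflTransGen (Step l A k x y) a b) :
    Relation.ReflTransGen (Step l A k y x) b a := by
  induction h with
  | refl => exact .refl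
  | tail _ hs ih => exact .head (hs.symm hl) ih

open Classical in
/-- The labelling function of an edge-labelled graph, extended by zero. -/
noncomputable def labelFun (G : SimpleGraph V) (lab : Sym2 V → ℕ) (a b : V) : ℕ :=
  if G.Adj a b then lab s(a, b) else 0

section labelFun

variable {G : SimpleGraph V} {lab : Sym2 V → ℕ}

lemma isLabelFun_labelFun : IsLabelFun (labelFun G lab) := by
  constructor
  · intro a b; by_cases h : G.Adj a b <;> simp [labelFun, h, G.adj_comm b a, Sym2.eq_swap (a := a)]
  · intro a; simp [labelFun]

lemma labelFun_of_adj {a b : V} (h : G.Adj a b) : labelFun G lab a b = lab s(a, b) := by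
  simp [labelFun, h]

lemma labelFun_pos_iff (hpos : ∀ e ∈ G.edgeSet, 1 ≤ lab e) {a b : V} :
    0 < labelFun G lab a b ↔ G.Adj a b := by
  unfold labelFun
  split_ifs with h
  · exact ⟨fun _ => h, fun _ => hpos s(a, b) h⟩
  · simp [h]

lemma labelFun_eq_iff {k : ℕ} (hk : 0 < k) {a b : V} :
    labelFun G lab a b = k ↔ G.Adj a b ∧ lab s(a, b) = k := by
  unfold labelFun
  split_ifs with h
  · simp [h]
  · simp only [h, false_and, iff_false]; omega

lemma forall_isAcyclic_iff [Fintype V] (hpos : ∀ e ∈ G.edgeSet, 1 ≤ lab e) :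
    (∀ k : ℕ, ∀ e ∈ G.edgeSet, lab e ≤ k →
      (SimpleGraph.fromEdgeSet {f | (f ∈ G.edgeSet ∧ lab f = k) ∨ f = e}).IsAcyclic) ↔
    ∀ k, ∀ x ∈ Finset.univ, ∀ y ∈ Finset.univ, 0 < labelFun G lab x y → labelFun G lab x y ≤ k →
      ¬ Relation.ReflTransGen (Step (labelFun G lab) Finset.univ k x y) x y := by
  constructor
  · intro h k x _ y _ h0 hk hr
    have hxy := (labelFun_pos_iff hpos).1 h0
    have hk0 : 0 < k := by omega
    rw [labelFun_of_adj hxy] at hk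
    have hb := SimpleGraph.isAcyclic_iff_forall_adj_isBridge.1 (h k s(x, y) hxy hk) (v := x) (w := y)
      (by simp [hxy.ne])
    rw [SimpleGraph.isBridge_iff, SimpleGraph.reachable_iff_reflTransGen] at hb
    refine hb (Relation.ReflTransGen.mono ?_ _ _ hr)
    rintro a b ⟨-, -, hab, hne⟩
    have hab := (labelFun_eq_iff hk0).1 hab
    rw [SimpleGraph.deleteEdges_adj, SimpleGraph.fromEdgeSet_adj]
    exact ⟨⟨Or.inl hab, hab.1.ne⟩, hne⟩
  · intro h k e he hk
    induction e using Sym2.ind with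
    | _ x y =>
    have hk0 : 0 < k := (hpos _ he).trans hk
    set D := SimpleGraph.fromEdgeSet {f | f ∈ G.edgeSet ∧ lab f = k} with hD
    have hDadj : ∀ {a b}, D.Adj a b ↔ labelFun G lab a b = k := by
      intro a b
      rw [labelFun_eq_iff hk0, hD, SimpleGraph.fromEdgeSet_adj]
      exact ⟨fun h => h.1, fun h => ⟨h, h.1.ne⟩⟩
    have hF : SimpleGraph.fromEdgeSet {f | (f ∈ G.edgeSet ∧ lab f = k) ∨ f = s(x, y)} =
        D ⊔ SimpleGraph.edge x y := by
      ext a b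
      simp only [hD, SimpleGraph.edge, SimpleGraph.sup_adj, SimpleGraph.fromEdgeSet_adj,
        Set.mem_ofPred_eq, Set.mem_singleton_iff]
      tauto
    rw [hF, SimpleGraph.isAcyclic_sup_fromEdgeSet_iff]
    constructor
    · rw [SimpleGraph.isAcyclic_iff_forall_adj_isBridge]
      intro a b hab
      rw [SimpleGraph.isBridge_iff, SimpleGraph.reachable_iff_reflTransGen]
      rw [hDadj] at hab
      refine fun hr => h k a (by simp) b (by simp) (by omega) hab.le
        (Relation.ReflTransGen.mono ?_ _ _ hr)
      intro c d hcd
      rw [SimpleGraph.deleteEdges_adj, hDadj] at hcd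
      exact ⟨by simp, by simp, hcd⟩
    · intro hr
      rw [hDadj, or_iff_not_imp_right]
      intro hne
      rw [SimpleGraph.reachable_iff_reflTransGen] at hr
      refine absurd (Relation.ReflTransGen.mono ?_ _ _ hr)
        (h k x (by simp) y (by simp) ((labelFun_pos_iff hpos).2 he) (by rwa [labelFun_of_adj he]))
      intro a b hab
      rw [hDadj] at hab
      refine ⟨by simp, by simp, hab, fun e => hne ?_⟩
      rw [labelFun_eq_iff hk0, ← SimpleGraph.mem_edgeSet, e] at hab
      rw [labelFun_of_adj he, hab.2]

lemma matLabeling_iff [Fintype V] (hpos : ∀ e ∈ G.edgeSet, 1 ≤ lab e) :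
    MATLabeling G lab ↔ LabelingOn (labelFun G lab) Finset.univ := by
  have htri : ∀ {i j : V}, G.Adj i j →
      {w : V | G.Adj w i ∧ G.Adj w j ∧ lab s(w, i) < lab s(i, j) ∧
        lab s(w, j) < lab s(i, j)} = (apexes (labelFun G lab) Finset.univ i j : Set V) := by
    intro i j hij
    ext w
    simp only [Set.mem_ofPred_eq, Finset.mem_coe, mem_apexes, labelFun_pos_iff hpos,
      labelFun_of_adj hij, Finset.mem_univ, true_and]
    constructor
    · rintro ⟨a, b, c, d⟩
      rw [labelFun_of_adj a, labelFun_of_adj b]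
      exact ⟨⟨a, c⟩, b, d⟩
    · rintro ⟨⟨a, c⟩, b, d⟩
      rw [labelFun_of_adj a] at c
      rw [labelFun_of_adj b] at d
      exact ⟨a, b, c, d⟩
  constructor
  · rintro ⟨-, h1, h2⟩
    refine ⟨(forall_isAcyclic_iff hpos).1 h1, fun x _ y _ h0 => ?_⟩
    have hxy := (labelFun_pos_iff hpos).1 h0
    rw [labelFun_of_adj hxy, ← h2 x y hxy, htri hxy, Set.ncard_coe_finset]
  · intro h
    refine ⟨hpos, (forall_isAcyclic_iff hpos).2 h.acyclic, fun i j hij => ?_⟩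
    rw [htri hij, Set.ncard_coe_finset, ← labelFun_of_adj (lab := lab) hij]
    exact h.triangles i (by simp) j (by simp) ((labelFun_pos_iff hpos).2 hij)

lemma matSimplicial_induce_iff (hpos : ∀ e ∈ G.edgeSet, 1 ≤ lab e) {S : Set V}
    (hS : ∀ u, u ∈ S ↔ u ∈ A) (hv : v ∈ S) :
    MATSimplicial (G.induce S) (fun e => lab (Sym2.map Subtype.val e)) ⟨v, hv⟩ ↔
      SimplicialIn (labelFun G lab) A v := by
  have hN : Subtype.val '' ((G.induce S).neighborSet ⟨v, hv⟩) =
      (nbhd (labelFun G lab) A v : Set V) := by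
    ext u
    simp [labelFun_pos_iff hpos, ← hS, G.adj_comm v u, and_comm]
  have hcard : ((G.induce S).neighborSet ⟨v, hv⟩).ncard = (nbhd (labelFun G lab) A v).card := by
    rw [← Set.ncard_image_of_injective _ Subtype.val_injective, hN, Set.ncard_coe_finset]
  have himg : (fun u => lab (Sym2.map Subtype.val s(u, ⟨v, hv⟩))) ''
      ((G.induce S).neighborSet ⟨v, hv⟩) =
      ((nbhd (labelFun G lab) A v).image (labelFun G lab · v) : Set ℕ) := by
    rw [Finset.coe_image, ← hN, Set.image_image]
    refine Set.image_congr fun u hu => ?_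
    have : G.Adj u v := (G.adj_comm _ _).1 hu
    rw [labelFun_of_adj this, Sym2.map_mk]
  have hadj : ∀ (u : V) (hu : u ∈ S), (⟨u, hu⟩ : S) ∈ (G.induce S).neighborSet ⟨v, hv⟩ ↔
      G.Adj u v := fun u hu => by simp [G.adj_comm u v]
  unfold MATSimplicial
  rw [hcard, himg, ← Finset.coe_Icc, Finset.coe_inj]
  constructor
  · rintro ⟨h1, h2, h3⟩
    refine ⟨fun a ha b hb hab pa pb => ?_, h2⟩
    rw [labelFun_pos_iff hpos] at pa pb
    rw [← hS] at ha hb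
    have hne : (⟨a, ha⟩ : S) ≠ ⟨b, hb⟩ := fun e => hab (congrArg Subtype.val e)
    have e1 : G.Adj a b := h1 _ ((hadj a ha).2 pa) _ ((hadj b hb).2 pb) hne
    have e3 := h3 _ ((hadj a ha).2 pa) _ ((hadj b hb).2 pb) hne
    rw [labelFun_pos_iff hpos, labelFun_of_adj pa, labelFun_of_adj pb, labelFun_of_adj e1]
    exact ⟨e1, e3⟩
  · rintro ⟨h1, h2⟩
    have key : ∀ a (ha : a ∈ S) b (hb : b ∈ S), (⟨a, ha⟩ : S) ≠ ⟨b, hb⟩ → G.Adj a v → G.Adj b v →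
        G.Adj a b ∧ lab s(a, b) < max (lab s(a, v)) (lab s(b, v)) := by
      intro a ha b hb hab pa pb
      have := h1 a ((hS a).1 ha) b ((hS b).1 hb) (fun e => hab (Subtype.ext e))
        ((labelFun_pos_iff hpos).2 pa) ((labelFun_pos_iff hpos).2 pb)
      have e1 := (labelFun_pos_iff hpos).1 this.1
      rw [labelFun_of_adj pa, labelFun_of_adj pb, labelFun_of_adj e1] at this
      exact ⟨e1, this.2⟩
    exact ⟨fun ⟨a, ha⟩ pa ⟨b, hb⟩ pb hab => (key a ha b hb hab ((hadj a ha).1 pa)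
        ((hadj b hb).1 pb)).1, h2,
      fun ⟨a, ha⟩ pa ⟨b, hb⟩ pb hab => (key a ha b hb hab ((hadj a ha).1 pa)
        ((hadj b hb).1 pb)).2⟩

/-- The labels along an MAT-perfect elimination ordering are positive. -/
lemma one_le_of_forall_matSimplicial {n : ℕ} (σ : Fin n ≃ V)
    (h : ∀ i : Fin n, MATSimplicial (G.induce {u : V | ∃ j, j ≤ i ∧ σ j = u})
      (fun e => lab (Sym2.map Subtype.val e)) ⟨σ i, ⟨i, le_refl i, rfl⟩⟩) :
    ∀ e ∈ G.edgeSet, 1 ≤ lab e := by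
  have main : ∀ i j : Fin n, j ≤ i → G.Adj (σ i) (σ j) → 1 ≤ lab s(σ j, σ i) := by
    intro i j hji hadj
    have hmem := Set.mem_image_of_mem
      (fun u : {u : V | ∃ j, j ≤ i ∧ σ j = u} => lab (Sym2.map Subtype.val
        s(u, ⟨σ i, ⟨i, le_refl i, rfl⟩⟩)))
      (show (⟨σ j, j, hji, rfl⟩ : {u : V | ∃ j, j ≤ i ∧ σ j = u}) ∈
        (G.induce {u : V | ∃ j, j ≤ i ∧ σ j = u}).neighborSet ⟨σ i, ⟨i, le_refl i, rfl⟩⟩ from hadj)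
    rw [(h i).2.1] at hmem
    exact hmem.1
  intro e he
  induction e using Sym2.ind with
  | _ a b =>
  obtain ⟨i, rfl⟩ := σ.surjective a
  obtain ⟨j, rfl⟩ := σ.surjective b
  rcases le_total j i with hji | hij
  · rw [Sym2.eq_swap]; exact main i j hji he
  · exact main j i hij he.symm

end labelFun

variable [DecidableEq V]

/-- `A` can be built up by successively adding MAT-simplicial vertices. -/
inductive Eliminable (l : V → V → ℕ) : Finset V → Prop
  | empty : Eliminable l ∅
  | grow {A : Finset V} {v : V} : Eliminable l A → v ∉ A → SimplicialIn l (insert v A) v →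
      Eliminable l (insert v A)

/-- Adding one more neighbour along an edge of the next label keeps `v` simplicial. -/
lemma SimplicialIn.add_top (hl : IsLabelFun l) (h : SimplicialIn l B v) (hBA : B ⊆ A) {t : V}
    (ht : t ∈ A) (htB : t ∉ B) (hA : ∀ u ∈ A, u ∉ B → 0 < l u v → u = t)
    (htop : l t v = (nbhd l B v).card + 1)
    (hadj : ∀ u ∈ nbhd l B v, 0 < l u t ∧ l u t < l t v) : SimplicialIn l A v := by
  have hN : nbhd l A v = insert t (nbhd l B v) := by
    ext u
    simp only [mem_nbhd, Finset.mem_insert]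
    constructor
    · rintro ⟨a, b⟩
      by_cases hu : u ∈ B
      · exact Or.inr ⟨hu, b⟩
      · exact Or.inl (hA u a hu b)
    · rintro (rfl | ⟨a, b⟩)
      · exact ⟨ht, by omega⟩
      · exact ⟨hBA a, b⟩
  constructor
  · intro a ha b hb hab pa pb
    have ha' : a ∈ nbhd l A v := mem_nbhd.2 ⟨ha, pa⟩
    have hb' : b ∈ nbhd l A v := mem_nbhd.2 ⟨hb, pb⟩
    rw [hN, Finset.mem_insert] at ha' hb'
    rcases ha' with rfl | ha' <;> rcases hb' with rfl | hb'
    · exact absurd rfl hab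
    · have := hadj b hb'
      rw [hl.symm a b]
      exact ⟨this.1, lt_max_of_lt_left this.2⟩
    · have := hadj a ha'
      exact ⟨this.1, lt_max_of_lt_right this.2⟩
    · exact h.adj a (mem_nbhd.1 ha').1 b (mem_nbhd.1 hb').1 hab pa pb
  · have htN : t ∉ nbhd l B v := fun h => htB (mem_nbhd.1 h).1
    rw [hN, Finset.card_insert_of_notMem htN, Finset.image_insert, h.labels, htop]
    ext k; simp only [Finset.mem_insert, Finset.mem_Icc]; omega

/-- Deleting a vertex which is simplicial, possibly after forgetting some of its neighbours along
edges of maximal label, preserves MAT-labelings. -/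
lemma LabelingOn.erase (hl : IsLabelFun l) (h : LabelingOn l A) {n : ℕ} (hn : ∀ a b, l a b ≤ n)
    (hB : ∀ u ∈ A, l u v ≠ n → u ∈ B) (hv : SimplicialIn l B v) : LabelingOn l (A.erase v) := by
  refine h.mono (A.erase_subset v) ?_
  intro x hx y hy w hw hwv h1 h2 h3 h4
  have : w = v := by simpa [hw] using hwv
  subst this
  rw [hl.symm w x] at h1 h2
  rw [hl.symm w y] at h3 h4
  have hxy : x ≠ y := by rintro rfl; rw [hl.self] at h2; omega
  have := hn x y
  have := (hv.adj x (hB x (Finset.mem_of_mem_erase hx) (by omega)) y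
    (hB y (Finset.mem_of_mem_erase hy) (by omega)) hxy h1 h3).2
  omega

/-- Every nonempty eliminable graph has two nonadjacent simplicial vertices, or else is complete
and has two (possibly equal) simplicial vertices realizing the largest label. -/
lemma Eliminable.exists_pair (hl : IsLabelFun l) (h : Eliminable l A) (hne : A.Nonempty) :
    ∃ x ∈ A, ∃ y ∈ A, SimplicialIn l A x ∧ SimplicialIn l A y ∧
      ((x ≠ y ∧ l x y = 0) ∨
        ((∀ a ∈ A, ∀ b ∈ A, a ≠ b → 0 < l a b) ∧ l x y = A.card - 1)) := by
  induction h with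
  | empty => simp at hne
  | @grow A v hA hv hs ih =>
    have key : ∀ x ∈ A, SimplicialIn l A x → l x v = 0 →
        ∃ x ∈ insert v A, ∃ y ∈ insert v A, SimplicialIn l (insert v A) x ∧
          SimplicialIn l (insert v A) y ∧ ((x ≠ y ∧ l x y = 0) ∨
            ((∀ a ∈ insert v A, ∀ b ∈ insert v A, a ≠ b → 0 < l a b) ∧
              l x y = (insert v A).card - 1)) := by
      intro x hx hsx h0
      refine ⟨x, by simp [hx], v, by simp, hsx.mono (by simp) ?_, hs, Or.inl ⟨?_, h0⟩⟩
      · intro u hu hu'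
        have : u = v := by simpa [hu'] using hu
        rw [this, hl.symm, h0]
      · rintro rfl; exact hv hx
    have hcard : (insert v A).card = A.card + 1 := Finset.card_insert_of_notMem hv
    rcases A.eq_empty_or_nonempty with rfl | hAne
    · exact ⟨v, by simp, v, by simp, hs, hs, Or.inr ⟨by simp, by simp [hl.self]⟩⟩
    obtain ⟨x, hx, y, hy, hsx, hsy, hxy⟩ := ih hAne
    by_cases hx0 : l x v = 0
    · exact key x hx hsx hx0
    by_cases hy0 : l y v = 0
    · exact key y hy hsy hy0
    rcases hxy with ⟨hne, h0⟩ | ⟨hc, hxy⟩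
    · have := (hs.adj x (by simp [hx]) y (by simp [hy]) hne (by omega) (by omega)).1
      omega
    have top : ∀ y ∈ A, SimplicialIn l A y → A.card ≤ l y v →
        ∃ x ∈ insert v A, ∃ y ∈ insert v A, SimplicialIn l (insert v A) x ∧
          SimplicialIn l (insert v A) y ∧ ((x ≠ y ∧ l x y = 0) ∨
            ((∀ a ∈ insert v A, ∀ b ∈ insert v A, a ≠ b → 0 < l a b) ∧
              l x y = (insert v A).card - 1)) := by
      intro y hy hsy hle
      have hpos : 0 < A.card := Finset.card_pos.2 hAne
      have hsub : nbhd l (insert v A) v ⊆ A := by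
        intro u hu
        rw [mem_nbhd] at hu
        rcases Finset.mem_insert.1 hu.1 with rfl | h
        · have := hl.self u; omega
        · exact h
      have hyN := hs.le_card (u := y) (mem_nbhd.2 ⟨by simp [hy], by omega⟩)
      have hNA : nbhd l (insert v A) v = A := Finset.eq_of_subset_of_card_le hsub (by omega)
      have hadj : ∀ a ∈ A, 0 < l a v := fun a ha => by
        rw [← hNA, mem_nbhd] at ha; exact ha.2
      rw [hNA] at hyN
      have hyv : l y v = A.card := le_antisymm hyN hle
      have hNy : nbhd l A y = A.erase y := by
        ext u
        simp only [mem_nbhd, Finset.mem_erase]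
        constructor
        · rintro ⟨a, b⟩
          refine ⟨?_, a⟩
          rintro rfl
          have := hl.self u; omega
        · rintro ⟨a, b⟩; exact ⟨b, hc u b y hy a⟩
      have hinj := hs.injOn
      refine ⟨y, by simp [hy], v, by simp, ?_, hs, Or.inr ⟨?_, by omega⟩⟩
      · refine hsy.add_top hl (by simp) (t := v) (by simp) hv ?_ ?_ ?_
        · intro u hu hu' _
          simpa [hu'] using hu
        · rw [hNy, Finset.card_erase_of_mem hy, hl.symm, hyv]; omega
        · intro u hu
          rw [hNy, Finset.mem_erase] at hu
          refine ⟨hadj u hu.2, ?_⟩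
          rw [hl.symm v y, hyv]
          refine lt_of_le_of_ne ?_ fun e => hu.1 (hinj ?_ ?_ (e.trans hyv.symm))
          · rw [← hNA]; exact hs.le_card (by rw [hNA]; exact hu.2)
          · rw [hNA]; exact hu.2
          · rw [hNA]; exact hy
      · intro a ha b hb hab
        rcases Finset.mem_insert.1 ha with rfl | ha' <;> rcases Finset.mem_insert.1 hb with rfl | hb'
        · exact absurd rfl hab
        · rw [hl.symm]; exact hadj b hb'
        · exact hadj a ha'
        · exact hc a ha' b hb' hab
    by_cases hle : A.card ≤ l y v
    · exact top y hy hsy hle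
    refine top x hx hsx ?_
    by_cases hne : x = y
    · subst hne
      rw [hl.self] at hxy
      omega
    · have := (hs.adj x (by simp [hx]) y (by simp [hy]) hne (by omega) (by omega)).2
      omega

lemma LabelingOn.grow (hl : IsLabelFun l) (h : LabelingOn l A) (hv : v ∉ A)
    (hs : SimplicialIn l (insert v A) v) : LabelingOn l (insert v A) := by
  have memA : ∀ {u}, u ∈ insert v A → u ≠ v → u ∈ A := fun hu hne =>
    (Finset.mem_insert.1 hu).resolve_left hne
  have ne_of_pos : ∀ {u}, 0 < l v u → u ≠ v := by
    rintro u hu rfl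
    rw [hl.self] at hu; omega
  constructor
  · intro k x hx y hy h0 hk hr
    have hk0 : 0 < k := by omega
    obtain ⟨u, hu⟩ : ∃ u, ∀ a ∈ insert v A, l v a = k → a = u := by
      by_cases hex : ∃ u ∈ insert v A, l v u = k
      · obtain ⟨u, hu, e⟩ := hex
        refine ⟨u, fun a ha e' => hs.injOn ?_ ?_ ?_⟩
        · exact mem_nbhd.2 ⟨ha, by rw [hl.symm]; omega⟩
        · exact mem_nbhd.2 ⟨hu, by rw [hl.symm]; omega⟩
        · exact (hl.symm a v).trans (e'.trans (e.symm.trans (hl.symm v u)))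
      · push Not at hex
        exact ⟨v, fun a ha e => absurd e (hex a ha)⟩
    have lift : ∀ x y a b, Relation.ReflTransGen (Step l (insert v A) k x y) a b →
        Relation.ReflTransGen (Step l A k x y) (if a = v then u else a)
          (if b = v then u else b) := by
      intro x y a b hr
      induction hr with
      | refl => exact .refl
      | @tail b c _ hst ih =>
        obtain ⟨hb, hc, hbc, hne⟩ := hst
        by_cases hbv : b = v
        · subst hbv
          have hcb : c ≠ b := ne_of_pos (by omega)
          have := hu c hc hbc
          rw [if_pos rfl] at ih
          rwa [if_neg hcb, this]
        · by_cases hcv : c = v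
          · subst hcv
            have := hu b hb (by rw [hl.symm, hbc])
            rw [if_neg hbv] at ih
            rw [if_pos rfl, ← this]
            simpa only [← this] using ih
          · rw [if_neg hbv] at ih
            rw [if_neg hcv]
            exact ih.tail ⟨memA hb hbv, memA hc hcv, hbc, hne⟩
    have main : ∀ y ∈ A, 0 < l v y → l v y ≤ k →
        ¬ Relation.ReflTransGen (Step l (insert v A) k v y) v y := by
      intro y hy h0 hk hr
      have hyv := ne_of_pos h0
      rcases hr.cases_head with e | ⟨c, ⟨-, hc, hvc, hne⟩, -⟩
      · exact hyv e.symm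
      have hcv : c ≠ v := ne_of_pos (by omega)
      have hcA := memA hc hcv
      have hcu := hu c hc hvc
      have hcy : c ≠ y := by rintro rfl; exact hne rfl
      have hadj := hs.adj c hc y (by simp [hy]) hcy (by rw [hl.symm]; omega) (by rwa [hl.symm])
      have hlt : l v y < k := by
        refine lt_of_le_of_ne hk fun e => hcy ?_
        rw [hcu, hu y (by simp [hy]) e]
      rw [hl.symm c v, hl.symm y v] at hadj
      have hr' := lift _ _ _ _ hr
      rw [if_pos rfl, if_neg hyv, ← hcu] at hr'
      refine h.acyclic k c hcA y hy hadj.1 (by omega) (Relation.ReflTransGen.mono ?_ _ _ hr')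
      rintro a b ⟨ha, hb, hab, -⟩
      refine ⟨ha, hb, hab, fun e => ?_⟩
      rcases Sym2.eq_iff.1 e with ⟨rfl, rfl⟩ | ⟨rfl, rfl⟩
      · omega
      · rw [hl.symm] at hab; omega
    by_cases hxv : x = v
    · subst hxv
      exact main y (memA hy (ne_of_pos h0)) h0 hk hr
    by_cases hyv : y = v
    · subst hyv
      rw [hl.symm] at h0 hk
      exact main x (memA hx hxv) h0 hk (reflTransGen_step_symm hl hr)
    have hr' := lift _ _ _ _ hr
    rw [if_neg hxv, if_neg hyv] at hr'
    exact h.acyclic k x (memA hx hxv) y (memA hy hyv) h0 hk hr'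
  · have main : ∀ y ∈ A, 0 < l v y → (apexes l (insert v A) v y).card = l v y - 1 := by
      intro y hy h0
      have hyN : y ∈ nbhd l (insert v A) v := mem_nbhd.2 ⟨by simp [hy], by rwa [hl.symm]⟩
      have himg : (apexes l (insert v A) v y).image (l · v) = Finset.Icc 1 (l v y - 1) := by
        ext j
        simp only [Finset.mem_image, mem_apexes, Finset.mem_Icc]
        constructor
        · rintro ⟨w, ⟨-, ⟨h1, h2⟩, -⟩, rfl⟩; omega
        · rintro ⟨h1, h2⟩
          have := hs.le_card hyN
          rw [hl.symm] at this
          obtain ⟨w, hw, rfl⟩ := hs.exists_label h1 (by omega)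
          have hwy : w ≠ y := by rintro rfl; rw [hl.symm] at h2; omega
          have := hs.adj w hw y (by simp [hy]) hwy (by omega) (by rwa [hl.symm])
          rw [hl.symm y v] at this
          exact ⟨w, ⟨hw, by omega, by omega⟩, rfl⟩
      rw [← Finset.card_image_of_injOn (f := (l · v)), himg]
      · simp
      · refine hs.injOn.mono fun w hw => ?_
        have := mem_apexes.1 (Finset.mem_coe.1 hw)
        exact mem_nbhd.2 ⟨this.1, this.2.1.1⟩
    intro x hx y hy h0
    by_cases hxv : x = v
    · subst hxv
      exact main y (memA hy (ne_of_pos h0)) h0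
    by_cases hyv : y = v
    · subst hyv
      rw [hl.symm] at h0
      rw [apexes_comm hl, hl.symm]
      exact main x (memA hx hxv) h0
    rw [← h.triangles x (memA hx hxv) y (memA hy hyv) h0]
    congr 1
    ext w
    simp only [mem_apexes]
    refine ⟨fun ⟨a, b⟩ => ⟨?_, b⟩, fun ⟨a, b⟩ => ⟨by simp [a], b⟩⟩
    refine memA a ?_
    rintro rfl
    have hxy : x ≠ y := by rintro rfl; rw [hl.self] at h0; omega
    rw [hl.symm w x, hl.symm w y] at b
    have := (hs.adj x hx y hy hxy b.1.1 b.2.1).2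
    omega

lemma Eliminable.labelingOn (hl : IsLabelFun l) (h : Eliminable l A) : LabelingOn l A := by
  induction h with
  | empty => exact ⟨by simp, by simp⟩
  | grow _ hv hs ih => exact ih.grow hl hv hs

/-- Descent along a tree of edges of maximal label `n`: if all vertices of a connected piece `R` of
such a tree have the same neighbourhood `W` along edges of smaller label, then there is a simplicial
vertex. -/
lemma LabelingOn.exists_simplicial_of_region (hl : IsLabelFun l) {n : ℕ} (hn : ∀ a b, l a b ≤ n)
    (hpos : 0 < n) (hA : LabelingOn l A)
    (ih : ∀ B : Finset V, B.card < A.card → LabelingOn l B → Eliminable l B)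
    {W : Finset V} (hWA : W ⊆ A) (hWcard : W.card = n - 1)
    (hW : ∀ a ∈ W, ∀ b ∈ W, a ≠ b → 0 < l a b) (R : Finset V) (hRA : R ⊆ A) (hR0 : R.Nonempty)
    (hRW : ∀ t ∈ R, ∀ u ∈ A, (0 < l u t ∧ l u t < n) ↔ u ∈ W)
    (hconn : ∀ t ∈ R, ∀ t' ∈ R,
      Relation.ReflTransGen (fun a b => a ∈ R ∧ b ∈ R ∧ l a b = n) t t')
    (hbd : ∃ p ∈ A \ R, ∃ q ∈ A \ R, p ≠ q ∧ (∃ t ∈ R, l p t = n) ∧ ∃ t ∈ R, l q t = n)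
    (hlab : LabelingOn l (A \ R)) : ∃ x ∈ A, SimplicialIn l A x := by
  induction hm : (A \ R).card using Nat.strong_induction_on generalizing R with
  | _ m IH =>
  have hBA : A \ R ⊆ A := Finset.sdiff_subset
  have hdisj : ∀ w ∈ W, w ∉ R := by
    intro w hw hwR
    have := ((hRW w hwR w (hWA hw)).2 hw).1
    rw [hl.self] at this; omega
  have hext : ∀ t ∈ R, ∀ u ∈ A, l u t = n → ∀ w ∈ W, 0 < l w u ∧ l w u < n := by
    intro t ht u hu hut w hw
    have hcard := hA.triangles u hu t (hRA ht) (by omega)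
    have hsub : apexes l A u t ⊆ W := by
      intro w hw
      obtain ⟨hwA, -, hw2⟩ := mem_apexes.1 hw
      rw [hut] at hw2
      exact (hRW t ht w hwA).1 hw2
    have heq := Finset.eq_of_subset_of_card_le hsub (by omega)
    rw [← heq, mem_apexes, hut] at hw
    exact hw.2.1
  have hsteps : ∀ x y, x ∉ R → ∀ t ∈ R, ∀ t' ∈ R,
      Relation.ReflTransGen (Step l A n x y) t t' := by
    intro x y hx t ht t' ht'
    refine Relation.ReflTransGen.mono ?_ _ _ (hconn t ht t' ht')
    rintro a b ⟨ha, hb, hab⟩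
    refine ⟨hRA ha, hRA hb, hab, fun e => hx ?_⟩
    rcases Sym2.eq_iff.1 e with ⟨rfl, rfl⟩ | ⟨rfl, rfl⟩ <;> assumption
  have hnonadj : ∀ p ∈ A \ R, ∀ q ∈ A \ R, p ≠ q → (∃ t ∈ R, l p t = n) →
      (∃ t ∈ R, l q t = n) → l p q = 0 := by
    rintro p hp q hq hpq ⟨t, ht, hpt⟩ ⟨t', ht', hqt⟩
    rw [Finset.mem_sdiff] at hp hq
    by_contra h0
    refine hA.acyclic n p hp.1 q hq.1 (by omega) (hn _ _) (.head (b := t) ?_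
      (.tail (b := t') (hsteps p q hp.2 t ht t' ht') ?_))
    · refine ⟨hp.1, hRA ht, hpt, fun e => ?_⟩
      rcases Sym2.eq_iff.1 e with ⟨-, rfl⟩ | ⟨h, -⟩
      · exact hq.2 ht
      · exact hpq h
    · refine ⟨hRA ht', hq.1, by rw [hl.symm, hqt], fun e => ?_⟩
      rcases Sym2.eq_iff.1 e with ⟨rfl, -⟩ | ⟨-, h⟩
      · exact hp.2 ht'
      · exact hpq h.symm
  have huniq : ∀ p ∈ A \ R, ∀ t ∈ R, ∀ t' ∈ R, l p t = n → l p t' = n → t' = t := by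
    intro p hp t ht t' ht' hpt hpt'
    rw [Finset.mem_sdiff] at hp
    by_contra hne
    refine hA.acyclic n p hp.1 t (hRA ht) (by omega) (hn _ _)
      (.head (b := t') ⟨hp.1, hRA ht', hpt', fun e => ?_⟩ (hsteps p t hp.2 t' ht' t ht))
    rcases Sym2.eq_iff.1 e with ⟨-, h⟩ | ⟨rfl, -⟩
    · exact hne h
    · exact hp.2 ht
  obtain ⟨p, hp, q, hq, hpq, hpt, hqt⟩ := hbd
  have hlt : (A \ R).card < A.card := by
    rw [Finset.card_sdiff_of_subset hRA]
    have := Finset.card_pos.2 hR0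
    have := Finset.card_le_card hRA
    omega
  obtain ⟨x, hx, hxW, hsx⟩ : ∃ x ∈ A \ R, x ∉ W ∧ SimplicialIn l (A \ R) x := by
    obtain ⟨x, hx, y, hy, hsx, hsy, ⟨hne, h0⟩ | ⟨hc, -⟩⟩ :=
      (ih _ hlt hlab).exists_pair hl ⟨p, hp⟩
    · by_cases hxW : x ∈ W
      · refine ⟨y, hy, fun hyW => ?_, hsy⟩
        have := hW x hxW y hyW hne
        omega
      · exact ⟨x, hx, hxW, hsx⟩
    · have := hc p hp q hq hpq
      have := hnonadj p hp q hq hpq hpt hqt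
      omega
  have hxA := (Finset.mem_sdiff.1 hx).1
  have hxR := (Finset.mem_sdiff.1 hx).2
  have mem_R : ∀ u ∈ A, u ∉ A \ R → u ∈ R := fun u hu hu' => by simpa [hu] using hu'
  have eq_n : ∀ t ∈ R, 0 < l t x → l x t = n := by
    intro t ht h0
    have := hn x t
    by_contra hne
    rw [hl.symm] at h0
    exact hxW ((hRW t ht x hxA).1 ⟨h0, by omega⟩)
  by_cases hxt : ∃ t ∈ R, l x t = n
  swap
  · push Not at hxt
    refine ⟨x, hxA, hsx.mono hBA fun u hu hu' => ?_⟩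
    by_contra h0
    exact hxt u (mem_R u hu hu') (eq_n u (mem_R u hu hu') (by omega))
  obtain ⟨t, ht, hxt⟩ := hxt
  have hWx := hext t ht x hxA hxt
  have hWN : W ⊆ nbhd l (A \ R) x := fun w hw =>
    mem_nbhd.2 ⟨Finset.mem_sdiff.2 ⟨hWA hw, hdisj w hw⟩, (hWx w hw).1⟩
  by_cases hz : ∃ z ∈ A \ R, l z x = n
  swap
  · push Not at hz
    have hNcard := hsx.card_lt (n := n)
      (fun u hu => lt_of_le_of_ne (hn _ _) (hz u hu)) hpos
    have hWeq := Finset.eq_of_subset_of_card_le hWN (by omega)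
    refine ⟨x, hxA, hsx.add_top hl hBA (hRA ht) (by simp [ht]) ?_ ?_ ?_⟩
    · intro u hu hu' h0
      exact huniq x hx t ht u (mem_R u hu hu') hxt (eq_n u (mem_R u hu hu') h0)
    · rw [← hWeq, hl.symm, hxt]; omega
    · intro u hu
      rw [← hWeq] at hu
      rw [hl.symm t x, hxt]
      exact (hRW t ht u (hWA hu)).2 hu
  obtain ⟨z, hz, hzx⟩ := hz
  have hzN : z ∈ nbhd l (A \ R) x := mem_nbhd.2 ⟨hz, by omega⟩
  have hzx_ne : z ≠ x := by rintro rfl; rw [hl.self] at hzx; omega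
  have hNcard := hsx.card_le (n := n) fun u _ => hn u x
  have hWeq : W = (nbhd l (A \ R) x).erase z := by
    refine Finset.eq_of_subset_of_card_le (fun w hw => Finset.mem_erase.2 ⟨?_, hWN hw⟩) ?_
    · rintro rfl
      have := hWx w hw
      omega
    · rw [Finset.card_erase_of_mem hzN]; omega
  have hsd : A \ insert x R = (A \ R).erase x := by
    ext u; simp only [Finset.mem_sdiff, Finset.mem_insert, Finset.mem_erase]; tauto
  have hcon1 : ∀ a ∈ R, ∀ b ∈ R,
      Relation.ReflTransGen (fun a b => a ∈ insert x R ∧ b ∈ insert x R ∧ l a b = n) a b := by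
    intro a ha b hb
    refine Relation.ReflTransGen.mono ?_ _ _ (hconn a ha b hb)
    rintro a b ⟨ha, hb, hab⟩
    exact ⟨by simp [ha], by simp [hb], hab⟩
  refine IH ((A \ R).erase x).card ?_ (insert x R) (Finset.insert_subset hxA hRA) (by simp)
    ?_ ?_ ?_ ?_ (by rw [hsd])
  · rw [← hm]; exact Finset.card_erase_lt_of_mem hx
  · intro s hs u hu
    rcases Finset.mem_insert.1 hs with rfl | hs
    · refine ⟨fun ⟨h0, h1⟩ => ?_, hWx u⟩
      have huR : u ∉ R := fun huR => by
        have := eq_n u huR h0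
        rw [hl.symm] at this; omega
      rw [hWeq, Finset.mem_erase, mem_nbhd]
      refine ⟨?_, by simp [hu, huR], h0⟩
      rintro rfl; omega
    · exact hRW s hs u hu
  · intro a ha b hb
    rcases Finset.mem_insert.1 ha with rfl | ha' <;> rcases Finset.mem_insert.1 hb with rfl | hb'
    · exact .refl
    · exact .head ⟨by simp, by simp [ht], hxt⟩ (hcon1 t ht b hb')
    · exact .tail (hcon1 a ha' t ht) ⟨by simp [ht], by simp, by rw [hl.symm, hxt]⟩
    · exact hcon1 a ha' b hb'
  · have aux : ∀ p ∈ A \ R, p ≠ x → (∃ t ∈ R, l p t = n) →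
        ∃ p ∈ A \ insert x R, ∃ q ∈ A \ insert x R, p ≠ q ∧
          (∃ t ∈ insert x R, l p t = n) ∧ ∃ t ∈ insert x R, l q t = n := by
      rintro p hp hpx ⟨s, hs, hps⟩
      refine ⟨z, by rw [hsd]; exact Finset.mem_erase.2 ⟨hzx_ne, hz⟩, p,
        by rw [hsd]; exact Finset.mem_erase.2 ⟨hpx, hp⟩, ?_, ⟨x, by simp, hzx⟩,
        ⟨s, by simp [hs], hps⟩⟩
      rintro rfl
      have := hnonadj z hp x hx hpx ⟨s, hs, hps⟩ ⟨t, ht, hxt⟩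
      omega
    by_cases hpx : p = x
    · exact aux q hq (fun h => hpq (hpx.trans h.symm)) hqt
    · exact aux p hp hpx hpt
  · rw [hsd]
    exact hlab.erase hl hn (fun u hu _ => hu) hsx


lemma LabelingOn.eliminable (hl : IsLabelFun l) {n : ℕ} (hn : ∀ a b, l a b ≤ n)
    (h : LabelingOn l A) : Eliminable l A := by
  induction n generalizing l A with
  | zero =>
    clear h
    have h0 : ∀ a b, l a b = 0 := fun a b => by have := hn a b; omega
    induction A using Finset.induction_on with
    | empty => exact .empty
    | insert v A hv ih => exact ih.grow hv ⟨by simp [h0], by simp [nbhd, h0]⟩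
  | succ m ihm =>
    set n := m + 1 with hnm
    have hn0 : 0 < n := by omega
    induction hc : A.card using Nat.strong_induction_on generalizing A with
    | _ c ihc =>
    rcases A.eq_empty_or_nonempty with rfl | hne
    · exact .empty
    have ihA : ∀ B : Finset V, B.card < A.card → LabelingOn l B → Eliminable l B :=
      fun B hB hBl => ihc B.card (hc ▸ hB) hBl rfl
    suffices ∃ x ∈ A, SimplicialIn l A x by
      obtain ⟨x, hx, hsx⟩ := this
      have hE := ihA _ (Finset.card_erase_lt_of_mem hx)
        (h.erase hl hn (fun u hu _ => hu) hsx)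
      rw [← Finset.insert_erase hx] at hsx ⊢
      exact hE.grow (by simp) hsx
    have hT : Eliminable (MATGraph.trunc n l) A := by
      refine ihm (hl.trunc n) (fun a b => ?_) (h.trunc n)
      unfold MATGraph.trunc
      split_ifs <;> omega
    obtain ⟨v, hv, -, -, hsT, -⟩ := hT.exists_pair (hl.trunc n) hne
    have hsv := hsT.of_trunc hn
    set B := A.filter (l · v ≠ n) with hB
    have hmemB : ∀ u, u ∈ B ↔ u ∈ A ∧ l u v ≠ n := fun u => by simp [hB]
    by_cases hex : ∃ t ∈ A, l t v = n
    swap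
    · push Not at hex
      exact ⟨v, hv, hsv.mono (A.filter_subset _) fun u hu hu' =>
        absurd ((hmemB u).2 ⟨hu, hex u hu⟩) hu'⟩
    obtain ⟨t, ht, htv⟩ := hex
    have hNcard : (nbhd l B v).card < n := hsv.card_lt
      (fun u hu => lt_of_le_of_ne (hn u v) ((hmemB u).1 hu).2) hn0
    have hap : apexes l A t v = nbhd l B v := by
      refine Finset.eq_of_subset_of_card_le (fun w hw => ?_) ?_
      · obtain ⟨hwA, -, h1, h2⟩ := mem_apexes.1 hw
        exact mem_nbhd.2 ⟨(hmemB w).2 ⟨hwA, by omega⟩, h1⟩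
      · rw [h.triangles t ht v hv (by omega)]; omega
    have hcard : (nbhd l B v).card = n - 1 := by
      rw [← hap, h.triangles t ht v hv (by omega), htv]
    have hNt : ∀ u ∈ nbhd l B v, 0 < l u t ∧ l u t < l t v := fun u hu => by
      rw [← hap, mem_apexes] at hu
      exact hu.2.1
    by_cases hex2 : ∃ s ∈ A, s ≠ t ∧ l s v = n
    swap
    · push Not at hex2
      refine ⟨v, hv, hsv.add_top hl (A.filter_subset _) ht
        (fun h => ((hmemB t).1 h).2 htv) ?_ (by omega) hNt⟩
      intro u hu hu' _
      by_contra hut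
      exact hu' ((hmemB u).2 ⟨hu, hex2 u hu hut⟩)
    obtain ⟨s, hs, hst, hsv'⟩ := hex2
    have ne_v : ∀ u, l u v = n → u ≠ v := by
      rintro u hu rfl
      rw [hl.self] at hu; omega
    have hsd : A \ {v} = A.erase v := Finset.sdiff_singleton_eq_erase v A
    refine h.exists_simplicial_of_region hl hn hn0 ihA (W := nbhd l B v) (fun u hu => ?_) hcard ?_
      {v} (by simpa using hv) (by simp) ?_ ?_ ?_ ?_
    · exact ((hmemB u).1 (mem_nbhd.1 hu).1).1
    · intro a ha b hb hab
      rw [mem_nbhd] at ha hb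
      exact (hsv.adj a ha.1 b hb.1 hab ha.2 hb.2).1
    · intro v' hv' u hu
      rw [Finset.mem_singleton.1 hv', mem_nbhd, hmemB]
      have := hn u v
      constructor
      · rintro ⟨a, b⟩; exact ⟨⟨hu, by omega⟩, a⟩
      · rintro ⟨⟨a, b⟩, c⟩; exact ⟨c, by omega⟩
    · intro a ha b hb
      rw [Finset.mem_singleton.1 ha, Finset.mem_singleton.1 hb]
    · exact ⟨s, by simp [hs, ne_v s hsv'], t, by simp [ht, ne_v t htv], hst,
        ⟨v, by simp, hsv'⟩, v, by simp, htv⟩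
    · rw [hsd]
      exact h.erase hl hn (fun u hu hu' => (hmemB u).2 ⟨hu, hu'⟩) hsv

lemma Eliminable.exists_enumeration [Nonempty V] (h : Eliminable l A) :
    ∃ f : ℕ → V, Set.InjOn f (Finset.range A.card) ∧ (Finset.range A.card).image f = A ∧
      ∀ i < A.card, SimplicialIn l ((Finset.range (i + 1)).image f) (f i) := by
  induction h with
  | empty => exact ⟨fun _ => Classical.arbitrary V, by simp⟩
  | @grow A v _ hv hs ih =>
    obtain ⟨f, hinj, himg, hf⟩ := ih
    have heq : ∀ j < A.card, Function.update f A.card v j = f j := fun j hj =>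
      Function.update_of_ne hj.ne _ _
    have himage : ∀ m ≤ A.card, (Finset.range m).image (Function.update f A.card v) =
        (Finset.range m).image f := fun m hm =>
      Finset.image_congr fun j hj => heq j ((Finset.mem_range.1 hj).trans_le hm)
    have hins : (Finset.range (A.card + 1)).image (Function.update f A.card v) = insert v A := by
      rw [Finset.range_add_one, Finset.image_insert, himage _ le_rfl, himg, Function.update_self]
    rw [Finset.card_insert_of_notMem hv]
    refine ⟨Function.update f A.card v, ?_, hins, fun i hi => ?_⟩
    · rw [← Finset.card_image_iff, hins, Finset.card_insert_of_notMem hv, Finset.card_range]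
    · rcases Nat.lt_succ_iff_lt_or_eq.1 hi with hi | rfl
      · rw [himage _ hi, heq i hi]
        exact hf i hi
      · rw [hins, Function.update_self]
        exact hs

lemma eliminable_univ_iff [Fintype V] : Eliminable l Finset.univ ↔
    ∃ σ : Fin (Fintype.card V) ≃ V, ∀ i, SimplicialIn l ((Finset.Iic i).image σ) (σ i) := by
  constructor
  · intro h
    rcases isEmpty_or_nonempty V with hV | hV
    · exact ⟨(Fintype.equivFin V).symm, fun i => isEmptyElim ((Fintype.equivFin V).symm i)⟩
    obtain ⟨f, hinj, -, hf⟩ := h.exists_enumeration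
    rw [Finset.card_univ] at hinj hf
    have hbij : Function.Bijective fun i : Fin (Fintype.card V) => f i := by
      rw [Fintype.bijective_iff_injective_and_card]
      exact ⟨fun i j e => Fin.ext (hinj (by simp) (by simp) e), by simp⟩
    refine ⟨Equiv.ofBijective _ hbij, fun i => ?_⟩
    suffices (Finset.Iic i).image (Equiv.ofBijective _ hbij) = (Finset.range (i + 1)).image f by
      rw [this]; exact hf i i.2
    ext u
    simp only [Finset.mem_image, Finset.mem_Iic, Finset.mem_range, Equiv.ofBijective_apply]
    constructor
    · rintro ⟨j, hj, rfl⟩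
      exact ⟨j, Nat.lt_succ_of_le hj, rfl⟩
    · rintro ⟨j, hj, rfl⟩
      exact ⟨⟨j, by omega⟩, Nat.le_of_lt_succ hj, rfl⟩
  · rintro ⟨σ, hσ⟩
    suffices ∀ m ≤ Fintype.card V, Eliminable l (Finset.univ.filter fun u => (σ.symm u).val < m) by
      simpa using this _ le_rfl
    intro m
    induction m with
    | zero => intro _; simpa using Eliminable.empty
    | succ m ih =>
      intro hm
      have hins : (Finset.univ.filter fun u => (σ.symm u).val < m + 1) =
          insert (σ ⟨m, hm⟩) (Finset.univ.filter fun u => (σ.symm u).val < m) := by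
        ext u
        simp only [Finset.mem_filter, Finset.mem_univ, true_and, Finset.mem_insert,
          ← σ.symm_apply_eq, Fin.ext_iff]
        omega
      have hIic : (Finset.Iic (⟨m, hm⟩ : Fin (Fintype.card V))).image σ =
          Finset.univ.filter fun u => (σ.symm u).val < m + 1 := by
        ext u
        simp only [Finset.mem_image, Finset.mem_Iic, Finset.mem_filter, Finset.mem_univ, true_and,
          ← σ.eq_symm_apply]
        simp [Fin.le_def]
      have hs := hσ ⟨m, hm⟩
      rw [hIic, hins] at hs
      rw [hins]
      exact (ih (by omega)).grow (by simp) hs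

end MATGraph

/-- An edge-labeled graph is an MAT-labeled graph iff it admits an MAT-perfect elimination
ordering: an ordering `σ` of the vertices such that each `σ i` is MAT-simplicial in the
induced edge-labeled subgraph on `{σ 0, …, σ i}`. -/
theorem MATLabeling_iff_exists_MATPEO {V : Type*} [Fintype V]
    (G : SimpleGraph V) (lab : Sym2 V → ℕ) :
    MATLabeling G lab ↔
      ∃ σ : Fin (Fintype.card V) ≃ V,
        ∀ i : Fin (Fintype.card V),
          MATSimplicial (G.induce {u : V | ∃ j, j ≤ i ∧ σ j = u})
            (fun e => lab (Sym2.map Subtype.val e))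
            ⟨σ i, ⟨i, le_refl i, rfl⟩⟩ := by
  classical
  have hl := MATGraph.isLabelFun_labelFun (G := G) (lab := lab)
  have hS : ∀ (σ : Fin (Fintype.card V) ≃ V) (i : Fin (Fintype.card V)) (u : V),
      u ∈ {u : V | ∃ j, j ≤ i ∧ σ j = u} ↔ u ∈ (Finset.Iic i).image σ := fun σ i u => by simp
  constructor
  · intro h
    obtain ⟨σ, hσ⟩ := MATGraph.eliminable_univ_iff.1 (((MATGraph.matLabeling_iff h.1).1 h).eliminable
      hl (n := Finset.univ.sup fun p : V × V => MATGraph.labelFun G lab p.1 p.2)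
      fun a b => Finset.le_sup (f := fun p : V × V => MATGraph.labelFun G lab p.1 p.2)
        (Finset.mem_univ (a, b)))
    exact ⟨σ, fun i => (MATGraph.matSimplicial_induce_iff h.1 (hS σ i) _).2 (hσ i)⟩
  · rintro ⟨σ, hσ⟩
    have hpos := MATGraph.one_le_of_forall_matSimplicial σ hσ
    rw [MATGraph.matLabeling_iff hpos]
    exact (MATGraph.eliminable_univ_iff.2 ⟨σ, fun i =>
      (MATGraph.matSimplicial_induce_iff hpos (hS σ i) _).1 (hσ i)⟩).labelingOn hl
end
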